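/- arXiv:1803.02513 — 3 statements merged into one kernel-verified Lean document; each statement's English description precedes it below -/
import Mathlib

section
/- Let v > 1/2 and let K_v(x) = ∫_0^∞ e^{−x·cosh t}·cosh(vt) dt for x > 0. Then the function Λ(x) = x + x·K_v′(x)/K_v(x) is strictly increasing on (0,∞), with lim_{x→0⁺} Λ(x) = −v and lim_{x→∞} Λ(x) = −1/2; in particular −v < Λ(x) < −1/2 for all x > 0. -/
open Real Filter Set MeasureTheory Topology

lemma one_add_sq_div_two_le_cosh {t : ℝ} (ht : 0 ≤ t) : 1 + t ^ 2 / 2 ≤ cosh t := by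
  have h1 : t / 2 ≤ sinh (t / 2) := self_le_sinh_iff.2 (by positivity)
  have h2 : cosh t = cosh (t / 2) ^ 2 + sinh (t / 2) ^ 2 := by
    rw [← cosh_two_mul]; congr 1; ring
  nlinarith [cosh_sq (t / 2)]

lemma exp_neg_mul_cosh_mul_exp_le {x t : ℝ} (hx : 0 < x) (ht : 0 ≤ t) (w : ℝ) :
    exp (-x * cosh t) * exp (w * t) ≤ exp ((w + 1) ^ 2 / (2 * x)) * exp (-t) := by
  rw [← exp_add, ← exp_add, exp_le_exp]
  have h1 := mul_le_mul_of_nonneg_left (one_add_sq_div_two_le_cosh ht) hx.le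
  have h2 : (w + 1) ^ 2 / (2 * x) - (w + 1) * t + x * t ^ 2 / 2
      = (w + 1 - x * t) ^ 2 / (2 * x) := by
    field_simp; ring
  have h3 : 0 ≤ (w + 1 - x * t) ^ 2 / (2 * x) := by positivity
  nlinarith

/-- A continuous function of at most exponential growth on the positive half-line. -/
def HasExpGrowth (f : ℝ → ℝ) : Prop :=
  Continuous f ∧ ∃ C w : ℝ, 0 ≤ C ∧ 0 ≤ w ∧ ∀ t, 0 ≤ t → |f t| ≤ C * exp (w * t)

namespace HasExpGrowth

variable {f g : ℝ → ℝ} {x : ℝ}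

lemma of_abs_le (hf : Continuous f) {C : ℝ} (h : ∀ t, |f t| ≤ C) : HasExpGrowth f :=
  ⟨hf, C, 0, (abs_nonneg _).trans (h 0), le_rfl, fun t _ => by simpa using h t⟩

lemma const (c : ℝ) : HasExpGrowth fun _ => c :=
  of_abs_le continuous_const fun _ => le_rfl

lemma add (hf : HasExpGrowth f) (hg : HasExpGrowth g) : HasExpGrowth fun t => f t + g t := by
  obtain ⟨hf, C, w, hC, hw, h⟩ := hf
  obtain ⟨hg, D, u, hD, hu, k⟩ := hg
  refine ⟨hf.add hg, C + D, w + u, by positivity, by positivity, fun t ht => ?_⟩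
  have h1 : exp (w * t) ≤ exp ((w + u) * t) := exp_le_exp.2 (by nlinarith [mul_nonneg hu ht])
  have h2 : exp (u * t) ≤ exp ((w + u) * t) := exp_le_exp.2 (by nlinarith [mul_nonneg hw ht])
  calc |f t + g t| ≤ |f t| + |g t| := abs_add_le _ _
    _ ≤ C * exp (w * t) + D * exp (u * t) := add_le_add (h t ht) (k t ht)
    _ ≤ C * exp ((w + u) * t) + D * exp ((w + u) * t) := by gcongr
    _ = _ := by ring

lemma mul (hf : HasExpGrowth f) (hg : HasExpGrowth g) : HasExpGrowth fun t => f t * g t := by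
  obtain ⟨hf, C, w, hC, hw, h⟩ := hf
  obtain ⟨hg, D, u, hD, hu, k⟩ := hg
  refine ⟨hf.mul hg, C * D, w + u, by positivity, by positivity, fun t ht => ?_⟩
  calc |f t * g t| = |f t| * |g t| := abs_mul _ _
    _ ≤ (C * exp (w * t)) * (D * exp (u * t)) := by
      gcongr
      · exact h t ht
      · exact k t ht
    _ = _ := by rw [add_mul, exp_add]; ring

lemma neg (hf : HasExpGrowth f) : HasExpGrowth fun t => -f t := by
  simpa using (const (-1)).mul hf

lemma sub (hf : HasExpGrowth f) (hg : HasExpGrowth g) : HasExpGrowth fun t => f t - g t := by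
  simpa [sub_eq_add_neg] using hf.add hg.neg

lemma cosh_mul (a : ℝ) : HasExpGrowth fun t => cosh (a * t) := by
  refine ⟨by fun_prop, 1, |a|, zero_le_one, abs_nonneg a, fun t ht => ?_⟩
  rw [abs_of_pos (cosh_pos _), ← cosh_abs, abs_mul, abs_of_nonneg ht, one_mul]
  have h : sinh (|a| * t) ≥ 0 := sinh_nonneg_iff.2 (by positivity)
  linarith [cosh_add_sinh (|a| * t)]

lemma sinh_mul (a : ℝ) : HasExpGrowth fun t => sinh (a * t) := by
  obtain ⟨-, C, w, hC, hw, h⟩ := cosh_mul a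
  refine ⟨by fun_prop, C, w, hC, hw, fun t ht => le_trans ?_ (h t ht)⟩
  rw [abs_of_pos (cosh_pos _)]
  exact abs_le.2 ⟨by linarith [cosh_add_sinh (a * t), exp_pos (a * t)], (sinh_lt_cosh _).le⟩

lemma cosh : HasExpGrowth Real.cosh := by simpa using cosh_mul 1

lemma sinh : HasExpGrowth Real.sinh := by simpa using sinh_mul 1

lemma inv_cosh_add_one : HasExpGrowth fun t => (Real.cosh t + 1)⁻¹ := by
  have h (t : ℝ) : 1 ≤ Real.cosh t + 1 := by linarith [one_le_cosh t]
  refine of_abs_le (C := 1) ?_ fun t => ?_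
  · exact (continuous_cosh.add continuous_const).inv₀ fun t => (zero_lt_one.trans_le (h t)).ne'
  · rw [abs_of_nonneg (inv_nonneg.2 (zero_le_one.trans (h t)))]
    exact inv_le_one_of_one_le₀ (h t)

lemma exists_bound (hf : HasExpGrowth f) (hx : 0 < x) :
    ∃ C, ∀ y, x ≤ y → ∀ t, 0 ≤ t → ‖exp (-y * Real.cosh t) * f t‖ ≤ C * exp (-t) := by
  obtain ⟨-, C, w, hC, hw, h⟩ := hf
  refine ⟨C * exp ((w + 1) ^ 2 / (2 * x)), fun y hy t ht => ?_⟩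
  rw [norm_mul, norm_of_nonneg (exp_pos _).le, Real.norm_eq_abs]
  have h1 : exp (-y * Real.cosh t) ≤ exp (-x * Real.cosh t) :=
    exp_le_exp.2 (by nlinarith [cosh_pos t])
  calc exp (-y * Real.cosh t) * |f t|
      ≤ exp (-x * Real.cosh t) * (C * exp (w * t)) := by gcongr; exact h t ht
    _ = C * (exp (-x * Real.cosh t) * exp (w * t)) := by ring
    _ ≤ C * (exp ((w + 1) ^ 2 / (2 * x)) * exp (-t)) :=
      mul_le_mul_of_nonneg_left (exp_neg_mul_cosh_mul_exp_le hx ht w) hC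
    _ = _ := by ring

lemma integrableOn (hf : HasExpGrowth f) (hx : 0 < x) :
    IntegrableOn (fun t => exp (-x * Real.cosh t) * f t) (Ioi 0) := by
  obtain ⟨C, hC⟩ := hf.exists_bound hx
  have hc := hf.1
  refine Integrable.mono' ((integrableOn_exp_neg_Ioi 0).const_mul C)
    (by fun_prop : Continuous _).aestronglyMeasurable ?_
  filter_upwards [ae_restrict_mem measurableSet_Ioi] with t ht
  exact hC x le_rfl t (le_of_lt ht)

lemma tendsto_zero (hf : HasExpGrowth f) (hx : 0 < x) :
    Tendsto (fun t => exp (-x * Real.cosh t) * f t) atTop (𝓝 0) := by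
  obtain ⟨C, hC⟩ := hf.exists_bound hx
  refine squeeze_zero_norm' (a := fun t => C * exp (-t)) ?_ ?_
  · filter_upwards [eventually_ge_atTop 0] with t ht using hC x le_rfl t ht
  · simpa using (tendsto_exp_neg_atTop_nhds_zero).const_mul C

end HasExpGrowth

/-- The Laplace-type transform `x ↦ ∫_0^∞ e^{-x cosh t} f(t) dt`. -/
noncomputable def coshLaplace (f : ℝ → ℝ) (x : ℝ) : ℝ :=
  ∫ t in Ioi (0 : ℝ), exp (-x * cosh t) * f t

section coshLaplace

variable {f g : ℝ → ℝ} {x : ℝ}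

lemma coshLaplace_const_mul (c : ℝ) (f : ℝ → ℝ) (x : ℝ) :
    coshLaplace (fun t => c * f t) x = c * coshLaplace f x := by
  simp only [coshLaplace, ← integral_const_mul]
  congr 1 with t
  ring

lemma coshLaplace_add (hf : HasExpGrowth f) (hg : HasExpGrowth g) (hx : 0 < x) :
    coshLaplace (fun t => f t + g t) x = coshLaplace f x + coshLaplace g x := by
  simp only [coshLaplace, mul_add]
  exact integral_add (hf.integrableOn hx) (hg.integrableOn hx)

lemma coshLaplace_pos (hf : HasExpGrowth f) (hpos : ∀ t, 0 < t → 0 < f t) (hx : 0 < x) :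
    0 < coshLaplace f x := by
  have hpos' : ∀ t ∈ Ioi (0 : ℝ), 0 < exp (-x * cosh t) * f t := fun t ht =>
    mul_pos (exp_pos _) (hpos t ht)
  refine (setIntegral_pos_iff_support_of_nonneg_ae ?_ (hf.integrableOn hx)).2 ?_
  · filter_upwards [ae_restrict_mem measurableSet_Ioi] with t ht using (hpos' t ht).le
  · rw [inter_eq_right.2 fun t ht => Function.mem_support.2 (hpos' t ht).ne']
    simp

lemma coshLaplace_le (hf : HasExpGrowth f) (hpos : ∀ t, 0 < t → 0 < f t) (hx : 1 ≤ x) :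
    coshLaplace f x ≤ exp (1 - x) * coshLaplace f 1 := by
  have h0 : (0 : ℝ) < x := by linarith
  simp only [coshLaplace, ← integral_const_mul]
  refine setIntegral_mono_on (hf.integrableOn h0)
    ((hf.integrableOn zero_lt_one).const_mul _) measurableSet_Ioi fun t ht => ?_
  rw [← mul_assoc, ← exp_add]
  refine mul_le_mul_of_nonneg_right (exp_le_exp.2 ?_) (hpos t ht).le
  nlinarith [one_le_cosh t]

lemma tendsto_mul_coshLaplace (hf : HasExpGrowth f) (hpos : ∀ t, 0 < t → 0 < f t) (n : ℕ) :
    Tendsto (fun x => x ^ n * coshLaplace f x) atTop (𝓝 0) := by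
  have h := (tendsto_pow_mul_exp_neg_atTop_nhds_zero n).mul_const (exp 1 * coshLaplace f 1)
  rw [zero_mul] at h
  refine squeeze_zero' ?_ ?_ h
  · filter_upwards [eventually_gt_atTop 0] with x hx
    exact mul_nonneg (by positivity) (coshLaplace_pos hf hpos hx).le
  · filter_upwards [eventually_ge_atTop 1] with x hx
    refine (mul_le_mul_of_nonneg_left (coshLaplace_le hf hpos hx) (by positivity)).trans_eq ?_
    rw [sub_eq_add_neg, exp_add]
    ring

lemma hasDerivAt_coshLaplace (hf : HasExpGrowth f) (hx : 0 < x) :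
    HasDerivAt (coshLaplace f) (-coshLaplace (fun t => cosh t * f t) x) x := by
  have hf' : HasExpGrowth fun t => -1 * (cosh t * f t) :=
    (HasExpGrowth.const (-1)).mul (HasExpGrowth.cosh.mul hf)
  obtain ⟨C, hC⟩ := hf'.exists_bound (half_pos hx)
  have hc := hf.1
  have h := (hasDerivAt_integral_of_dominated_loc_of_deriv_le (μ := volume.restrict (Ioi (0 : ℝ)))
    (F := fun y t => exp (-y * cosh t) * f t)
    (F' := fun y t => exp (-y * cosh t) * (-1 * (cosh t * f t)))
    (bound := fun t => C * exp (-t)) (Ioi_mem_nhds (half_lt_self hx))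
    (.of_forall fun y => (by fun_prop : Continuous _).aestronglyMeasurable)
    (hf.integrableOn hx) (by fun_prop : Continuous _).aestronglyMeasurable ?_
    ((integrableOn_exp_neg_Ioi 0).const_mul C) ?_).2
  · rw [show -coshLaplace (fun t => cosh t * f t) x = -1 * _ from (neg_one_mul _).symm,
      ← coshLaplace_const_mul]
    exact h
  · filter_upwards [ae_restrict_mem measurableSet_Ioi] with t ht y hy
    exact hC y (le_of_lt hy) t (le_of_lt ht)
  · refine .of_forall fun t y _ => ?_
    refine (((hasDerivAt_id y).neg.mul_const (cosh t)).exp.mul_const (f t)).congr_deriv ?_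
    simp only [Pi.neg_apply, id]
    ring

/-- Integration by parts against the weight `e^{-x cosh t}`. -/
lemma coshLaplace_eq_neg_of_hasDerivAt (hf : HasExpGrowth f) (hg : HasExpGrowth g)
    (hderiv : ∀ t, HasDerivAt f (g t) t) (hx : 0 < x) :
    coshLaplace (fun t => g t - x * sinh t * f t) x = -(exp (-x) * f 0) := by
  have hs : HasExpGrowth fun t => g t - x * sinh t * f t :=
    hg.sub (((HasExpGrowth.const x).mul .sinh).mul hf)
  have := integral_Ioi_of_hasDerivAt_of_tendsto' (a := 0)
    (f := fun t => exp (-x * cosh t) * f t)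
    (f' := fun t => exp (-x * cosh t) * (g t - x * sinh t * f t)) (fun t _ => ?_)
    (hs.integrableOn hx) (hf.tendsto_zero hx)
  · simpa [coshLaplace] using this
  · refine (((hasDerivAt_cosh t).const_mul (-x)).exp.mul (hderiv t)).congr_deriv ?_
    ring

end coshLaplace

section Bessel

variable {v x : ℝ}

/-- The modified Bessel equation, for the integral representation of `K_v`. -/
lemma coshLaplace_bessel (v : ℝ) (hx : 0 < x) :
    x ^ 2 * coshLaplace (fun t => cosh t * (cosh t * cosh (v * t))) x
      = x * coshLaplace (fun t => cosh t * cosh (v * t)) x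
        + (x ^ 2 + v ^ 2) * coshLaplace (fun t => cosh (v * t)) x := by
  have hc := HasExpGrowth.cosh_mul v
  have hs := HasExpGrowth.sinh_mul v
  have hC := HasExpGrowth.cosh
  have hS := HasExpGrowth.sinh
  have h := coshLaplace_eq_neg_of_hasDerivAt (x := x)
    (f := fun t => x * (sinh t * cosh (v * t)) + v * sinh (v * t))
    (g := fun t => x * (cosh t * cosh (v * t) + sinh t * (v * sinh (v * t)))
      + v * (v * cosh (v * t)))
    (((HasExpGrowth.const x).mul (hS.mul hc)).add ((HasExpGrowth.const v).mul hs))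
    (((HasExpGrowth.const x).mul ((hC.mul hc).add (hS.mul ((HasExpGrowth.const v).mul hs)))).add
      ((HasExpGrowth.const v).mul ((HasExpGrowth.const v).mul hc)))
    (fun t => by
      have h1 : HasDerivAt (fun t => v * t) v t := by simpa using (hasDerivAt_id t).const_mul v
      refine ((((hasDerivAt_sinh t).mul h1.cosh).const_mul x).add
        (h1.sinh.const_mul v)).congr_deriv ?_
      ring) hx
  have h2 : (fun t => x * (cosh t * cosh (v * t) + sinh t * (v * sinh (v * t)))
      + v * (v * cosh (v * t)) - x * sinh t * (x * (sinh t * cosh (v * t)) + v * sinh (v * t)))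
      = fun t => (-x ^ 2) * (cosh t * (cosh t * cosh (v * t)))
        + (x * (cosh t * cosh (v * t)) + (x ^ 2 + v ^ 2) * cosh (v * t)) := by
    ext t
    linear_combination (-x ^ 2 * cosh (v * t)) * sinh_sq t
  rw [h2, coshLaplace_add ((HasExpGrowth.const _).mul (hC.mul (hC.mul hc)))
    (((HasExpGrowth.const _).mul (hC.mul hc)).add ((HasExpGrowth.const _).mul hc)) hx,
    coshLaplace_add ((HasExpGrowth.const _).mul (hC.mul hc)) ((HasExpGrowth.const _).mul hc) hx,
    coshLaplace_const_mul, coshLaplace_const_mul, coshLaplace_const_mul] at h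
  simp at h
  linarith

lemma cosh_sub_one_mul_cosh_lt (hv : 1 / 2 < v) {t : ℝ} (ht : 0 < t) :
    (cosh t - 1) * cosh (v * t) < 2 * v * sinh t * sinh (v * t) := by
  have h1 : cosh t = 1 + 2 * sinh (t / 2) ^ 2 := by
    have := cosh_two_mul (t / 2)
    rw [mul_div_cancel₀ t two_ne_zero] at this
    linarith [cosh_sq (t / 2)]
  have h2 : sinh t = 2 * sinh (t / 2) * cosh (t / 2) := by
    rw [← sinh_two_mul, mul_div_cancel₀ t two_ne_zero]
  have h3 : 0 < sinh (v * t - t / 2) := sinh_pos_iff.2 (by nlinarith)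
  rw [sinh_sub] at h3
  have h4 : 0 < sinh (t / 2) := sinh_pos_iff.2 (by positivity)
  have h5 : 0 < sinh (v * t) := sinh_pos_iff.2 (by nlinarith)
  have h6 : 0 < sinh (v * t) * cosh (t / 2) := mul_pos h5 (cosh_pos _)
  have h7 : sinh (t / 2) * cosh (v * t) < 2 * v * (sinh (v * t) * cosh (t / 2)) := by nlinarith
  rw [h2, h1]
  nlinarith

lemma one_add_two_mul_coshLaplace_lt (hv : 1 / 2 < v) (hx : 0 < x) :
    (1 + 2 * x) * coshLaplace (fun t => cosh (v * t)) x
      < 2 * x * coshLaplace (fun t => cosh t * cosh (v * t)) x := by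
  have hc := HasExpGrowth.cosh_mul v
  have hs := HasExpGrowth.sinh_mul v
  have hC := HasExpGrowth.cosh
  have hS := HasExpGrowth.sinh
  have hI := HasExpGrowth.inv_cosh_add_one
  have hq := hS.mul hI
  have hne (t : ℝ) : cosh t + 1 ≠ 0 := by linarith [cosh_pos t]
  have hg : HasExpGrowth fun t => 2 * ((cosh t + 1)⁻¹ * cosh (v * t)
      + sinh t * (cosh t + 1)⁻¹ * (v * sinh (v * t))) :=
    (HasExpGrowth.const 2).mul ((hI.mul hc).add (hq.mul ((HasExpGrowth.const v).mul hs)))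
  have h := coshLaplace_eq_neg_of_hasDerivAt (x := x)
    (f := fun t => 2 * (sinh t * (cosh t + 1)⁻¹ * cosh (v * t)))
    ((HasExpGrowth.const 2).mul (hq.mul hc)) hg
    (fun t => by
      have h1 : HasDerivAt (fun t => v * t) v t := by simpa using (hasDerivAt_id t).const_mul v
      have h2 := (hasDerivAt_sinh t).mul (((hasDerivAt_cosh t).add_const 1).inv (hne t))
      refine ((h2.mul h1.cosh).const_mul 2).congr_deriv ?_
      have := hne t
      simp only [Pi.mul_apply, Pi.inv_apply]
      field_simp
      linear_combination (-cosh (v * t)) * sinh_sq t) hx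
  have hpos := coshLaplace_pos (x := x)
    (f := fun t => (2 * v * sinh t * sinh (v * t) - (cosh t - 1) * cosh (v * t))
      * (cosh t + 1)⁻¹)
    ((((((HasExpGrowth.const (2 * v)).mul hS).mul hs).sub
      ((hC.sub (HasExpGrowth.const 1)).mul hc))).mul hI)
    (fun t ht => mul_pos (sub_pos.2 (cosh_sub_one_mul_cosh_lt hv ht))
      (inv_pos.2 (by linarith [cosh_pos t]))) hx
  have h2 : (fun t => (2 * v * sinh t * sinh (v * t) - (cosh t - 1) * cosh (v * t))
      * (cosh t + 1)⁻¹)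
      = fun t => (2 * ((cosh t + 1)⁻¹ * cosh (v * t)
        + sinh t * (cosh t + 1)⁻¹ * (v * sinh (v * t)))
        - x * sinh t * (2 * (sinh t * (cosh t + 1)⁻¹ * cosh (v * t))))
        + ((2 * x) * (cosh t * cosh (v * t)) + (-(1 + 2 * x)) * cosh (v * t)) := by
    ext t
    have := hne t
    field_simp
    linear_combination (2 * x * cosh (v * t)) * sinh_sq t
  rw [h2, coshLaplace_add (hg.sub (((HasExpGrowth.const x).mul hS).mul
      ((HasExpGrowth.const 2).mul (hq.mul hc))))
    (((HasExpGrowth.const _).mul (hC.mul hc)).add ((HasExpGrowth.const _).mul hc)) hx, h,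
    coshLaplace_add ((HasExpGrowth.const _).mul (hC.mul hc)) ((HasExpGrowth.const _).mul hc) hx,
    coshLaplace_const_mul, coshLaplace_const_mul] at hpos
  simp at hpos
  linarith

/-- The Riccati-type inequality equivalent to monotonicity of `x + x K_v′(x) / K_v(x)`. -/
lemma sq_mul_coshLaplace_sq_lt (hv : 1 / 2 < v) (hx : 0 < x) :
    x ^ 2 * coshLaplace (fun t => cosh t * cosh (v * t)) x ^ 2
      < (v ^ 2 + x + x ^ 2) * coshLaplace (fun t => cosh (v * t)) x ^ 2 := by
  have hc := HasExpGrowth.cosh_mul v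
  have hCc := HasExpGrowth.cosh.mul hc
  have hcpos (t : ℝ) (_ : 0 < t) : 0 < cosh (v * t) := cosh_pos _
  have hCcpos (t : ℝ) (_ : 0 < t) : 0 < cosh t * cosh (v * t) :=
    mul_pos (cosh_pos _) (cosh_pos _)
  set A := coshLaplace (fun t => cosh (v * t)) with hA
  set B := coshLaplace (fun t => cosh t * cosh (v * t)) with hB
  set H : ℝ → ℝ := fun y => (v ^ 2 + y + y ^ 2) * A y ^ 2 - y ^ 2 * B y ^ 2 with hH
  have hderiv (y : ℝ) (hy : 0 < y) :
      HasDerivAt H (A y * ((1 + 2 * y) * A y - 2 * y * B y)) y := by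
    have hA' : HasDerivAt A (-B y) y := hasDerivAt_coshLaplace hc hy
    have hB' := hasDerivAt_coshLaplace hCc hy
    have hid := hasDerivAt_id y
    have hode := coshLaplace_bessel v hy
    refine ((((hid.const_add (v ^ 2)).add (hid.pow 2)).mul (hA'.pow 2)).sub
      ((hid.pow 2).mul (hB'.pow 2))).congr_deriv ?_
    simp only [Pi.add_apply, Pi.pow_apply, id]
    norm_num
    linear_combination (2 * B y) * hode
  have hanti : StrictAntiOn H (Ioi 0) := by
    refine strictAntiOn_of_deriv_neg (convex_Ioi 0)
      (fun y hy => (hderiv y hy).continuousAt.continuousWithinAt) fun y hy => ?_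
    rw [interior_Ioi] at hy
    rw [(hderiv y hy).deriv]
    exact mul_neg_of_pos_of_neg (coshLaplace_pos hc hcpos hy)
      (sub_neg.2 (one_add_two_mul_coshLaplace_lt hv hy))
  have hlim : Tendsto H atTop (𝓝 0) := by
    have a0 := tendsto_mul_coshLaplace hc hcpos 0
    have a1 := tendsto_mul_coshLaplace hc hcpos 1
    have b1 := tendsto_mul_coshLaplace hCc hCcpos 1
    have := ((((a0.pow 2).const_mul (v ^ 2)).add (a1.mul a0)).add (a1.pow 2)).sub (b1.pow 2)
    convert this using 2
    · simp only [hH, hA, hB]; ring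
    · simp
  have hx1 : H (x + 1) < H x := hanti hx (by simp only [mem_Ioi]; linarith) (by linarith)
  have h0 : 0 ≤ H (x + 1) := by
    refine le_of_tendsto hlim ?_
    filter_upwards [eventually_ge_atTop (x + 1)] with y hy
    have h1 : (0 : ℝ) < x + 1 := by linarith
    exact hanti.antitoneOn h1 (h1.trans_le hy) hy
  have : 0 < H x := h0.trans_lt hx1
  simp only [hH] at this
  linarith

end Bessel

theorem stmt_14 (v : ℝ) (hv : 1 / 2 < v)
    (K : ℝ → ℝ)
    (hK : ∀ x, K x = ∫ t in Ioi (0 : ℝ), Real.exp (-x * Real.cosh t) * Real.cosh (v * t)) :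
    StrictMonoOn (fun x => x + x * deriv K x / K x) (Ioi 0) ∧
    Tendsto (fun x => x + x * deriv K x / K x) (𝓝[>] (0 : ℝ)) (𝓝 (-v)) ∧
    Tendsto (fun x => x + x * deriv K x / K x) atTop (𝓝 (-(1 / 2))) ∧
    ∀ x > (0 : ℝ), -v < x + x * deriv K x / K x ∧ x + x * deriv K x / K x < -(1 / 2) := by
  have hc := HasExpGrowth.cosh_mul v
  have hCc := HasExpGrowth.cosh.mul hc
  have hKA : K = coshLaplace fun t => cosh (v * t) := funext hK
  have hKpos (x : ℝ) (hx : 0 < x) : 0 < K x :=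
    hKA ▸ coshLaplace_pos hc (fun t _ => cosh_pos _) hx
  set B := coshLaplace (fun t => cosh t * cosh (v * t)) with hB
  have hK' (x : ℝ) (hx : 0 < x) : HasDerivAt K (-B x) x :=
    hKA ▸ hasDerivAt_coshLaplace hc hx
  have hB' (x : ℝ) (hx : 0 < x) := hasDerivAt_coshLaplace hCc hx
  set L : ℝ → ℝ := fun x => x + x * deriv K x / K x with hL
  have hLeq (x : ℝ) (hx : 0 < x) : L x = x - x * B x / K x := by
    simp only [hL, (hK' x hx).deriv]; ring
  have hupper (x : ℝ) (hx : 0 < x) : L x < -(1 / 2) := by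
    have h := one_add_two_mul_coshLaplace_lt hv hx
    rw [← hKA, ← hB] at h
    have h0 := hKpos x hx
    rw [hLeq x hx]
    have : x + 1 / 2 < x * B x / K x := by rw [lt_div_iff₀ h0]; linarith
    linarith
  have hric (x : ℝ) (hx : 0 < x) : 0 < v ^ 2 - L x ^ 2 + x * (1 + 2 * L x) := by
    have h := sq_mul_coshLaplace_sq_lt hv hx
    rw [← hKA, ← hB] at h
    have h0 := hKpos x hx
    have h1 : v ^ 2 - L x ^ 2 + x * (1 + 2 * L x)
        = ((v ^ 2 + x + x ^ 2) * K x ^ 2 - x ^ 2 * B x ^ 2) / K x ^ 2 := by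
      rw [hLeq x hx]; field_simp; ring
    rw [h1]
    exact div_pos (sub_pos.2 h) (by positivity)
  have hlower (x : ℝ) (hx : 0 < x) : -v < L x := by
    nlinarith [hric x hx, hupper x hx, mul_pos hx (by linarith [hupper x hx] : 0 < -(1 + 2 * L x))]
  have hLderiv (x : ℝ) (hx : 0 < x) :
      HasDerivAt L ((v ^ 2 - L x ^ 2 + x * (1 + 2 * L x)) / x) x := by
    have h0 := (hKpos x hx).ne'
    have hode := coshLaplace_bessel v hx
    rw [← hKA, ← hB] at hode
    have hid := hasDerivAt_id x
    have hBx := hB' x hx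
    generalize coshLaplace (fun t => cosh t * (cosh t * cosh (v * t))) x = D at hode hBx
    have h1 := hid.sub ((hid.mul hBx).div (hK' x hx) h0)
    refine (h1.congr_of_eventuallyEq ?_).congr_deriv ?_
    · filter_upwards [Ioi_mem_nhds hx] with y hy
      simp [hLeq y hy, ← hB]
    · simp only [hLeq x hx, Pi.mul_apply, id, ← hB]
      field_simp
      linear_combination (K x) * hode
  have hmono : StrictMonoOn L (Ioi 0) := by
    refine strictMonoOn_of_deriv_pos (convex_Ioi 0)
      (fun y hy => (hLderiv y hy).continuousAt.continuousWithinAt) fun y hy => ?_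
    rw [interior_Ioi] at hy
    rw [(hLderiv y hy).deriv]
    exact div_pos (hric y hy) hy
  refine ⟨hmono, ?_, ?_, fun x hx => ⟨hlower x hx, hupper x hx⟩⟩
  · rw [tendsto_order]
    refine ⟨fun a ha => ?_, fun a ha => ?_⟩
    · filter_upwards [self_mem_nhdsWithin] with x hx using ha.trans (hlower x hx)
    · suffices h : ∃ y, 0 < y ∧ L y < a by
        obtain ⟨y, hy, hya⟩ := h
        filter_upwards [Ioo_mem_nhdsGT hy] with x hx
        exact (hmono hx.1 hy hx.2).trans hya
      by_contra! hcon
      -- If `L ≥ a > -v` everywhere, then `L x - c log x` increases near zero, which is absurd.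
      set c := (v ^ 2 - a ^ 2) / 2 with hcdef
      have ha' : a < -(1 / 2) := (hcon 1 one_pos).trans_lt (hupper 1 one_pos)
      have hcpos : 0 < c := by nlinarith
      set δ := c / (2 * v) with hδ
      have hδpos : 0 < δ := div_pos hcpos (by linarith)
      have hδv : δ * (2 * v) = c := div_mul_cancel₀ _ (by linarith)
      have hM (x : ℝ) (hx : 0 < x) := (hLderiv x hx).sub ((hasDerivAt_log hx.ne').const_mul c)
      have hMmono : MonotoneOn (L - fun x => c * log x) (Ioc 0 δ) := by
        refine monotoneOn_of_deriv_nonneg (convex_Ioc 0 δ)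
          (fun y hy => (hM y hy.1).continuousAt.continuousWithinAt)
          (fun y hy => ?_) fun y hy => ?_
        all_goals rw [interior_Ioc] at hy
        · exact (hM y hy.1).differentiableAt.differentiableWithinAt
        · rw [(hM y hy.1).deriv, ← div_eq_mul_inv, ← sub_div]
          refine div_nonneg ?_ hy.1.le
          have h1 := hcon y hy.1
          have h2 := hupper y hy.1
          have h3 := hlower y hy.1
          have h4 : L y ^ 2 ≤ a ^ 2 := by nlinarith
          have h5 : y * (2 * v) ≤ c := by
            rw [← hδv]; exact mul_le_mul_of_nonneg_right hy.2.le (by linarith)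
          nlinarith [mul_pos hy.1 (by linarith : 0 < L y + v), hy.1]
      have hbot : Tendsto (fun x => L δ - c * log δ + c * log x) (𝓝[>] 0) atBot :=
        tendsto_atBot_add_const_left _ _ (tendsto_log_nhdsGT_zero.const_mul_atBot hcpos)
      obtain ⟨x, hx, hxδ⟩ := ((hbot.eventually_lt_atBot a).and (Ioc_mem_nhdsGT hδpos)).exists
      have h1 := hMmono hxδ ⟨hδpos, le_rfl⟩ hxδ.2
      simp only [Pi.sub_apply] at h1
      linarith [hcon x hxδ.1]
  · have hlow : Tendsto (fun x : ℝ => -(1 / 2) - v ^ 2 / 2 / x) atTop (𝓝 (-(1 / 2))) := by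
      simpa using (tendsto_const_nhds (x := -(1 / 2 : ℝ))).sub
        (tendsto_const_nhds (x := v ^ 2 / 2).div_atTop tendsto_id)
    refine tendsto_of_tendsto_of_tendsto_of_le_of_le' hlow tendsto_const_nhds ?_ ?_
    · filter_upwards [eventually_gt_atTop 0] with x hx
      have : -(1 / 2) - L x ≤ v ^ 2 / 2 / x := by
        rw [le_div_iff₀ hx]
        nlinarith [hric x hx, sq_nonneg (L x)]
      linarith
    · filter_upwards [eventually_gt_atTop 0] with x hx using (hupper x hx).le
end

section
/- Let 0 ≤ v < 1/2 and let K_v(x) = ∫_0^∞ e^{−x·cosh t}·cosh(vt) dt for x > 0. Then the function Λ(x) = x + x·K_v′(x)/K_v(x) is strictly decreasing on (0,∞), with lim_{x→0⁺} Λ(x) = −v and lim_{x→∞} Λ(x) = −1/2; in particular −1/2 < Λ(x) < −v for all x > 0. -/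
open Real Filter Set MeasureTheory Topology

section CoshWeight

lemma abs_sinh_le_cosh (t : ℝ) : |Real.sinh t| ≤ Real.cosh t := by
  rw [abs_le]
  constructor <;> linarith [Real.sinh_lt_cosh t, Real.exp_pos t, Real.cosh_add_sinh t]

lemma cosh_pow_mul_exp_neg_le {x : ℝ} (hx : 0 < x) (n : ℕ) (t : ℝ) :
    Real.exp (-x * Real.cosh t) * Real.cosh t ^ n ≤
      2 * ((n + 1).factorial / x ^ (n + 1)) * Real.exp (-t) := by
  have hc := Real.cosh_pos t
  have h1 := Real.pow_div_factorial_le_exp (x * Real.cosh t) (by positivity) (n + 1)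
  have h2 : Real.exp t ≤ 2 * Real.cosh t := by
    rw [Real.cosh_eq]; linarith [Real.exp_pos (-t)]
  have hf : (0 : ℝ) < (n + 1).factorial := by positivity
  rw [neg_mul, Real.exp_neg, Real.exp_neg, div_le_iff₀ hf, mul_pow] at *
  have h3 : Real.cosh t ^ n * Real.exp t * x ^ (n + 1) ≤
      2 * ((n + 1).factorial : ℝ) * Real.exp (x * Real.cosh t) := by
    calc Real.cosh t ^ n * Real.exp t * x ^ (n + 1)
        ≤ Real.cosh t ^ n * (2 * Real.cosh t) * x ^ (n + 1) := by gcongr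
      _ = 2 * (x ^ (n + 1) * Real.cosh t ^ (n + 1)) := by ring
      _ ≤ _ := by linarith
  have := Real.exp_pos t
  have := Real.exp_pos (x * Real.cosh t)
  rw [← mul_div_assoc, inv_mul_eq_div, ← div_eq_mul_inv, div_div, div_le_div_iff₀ (by positivity) (by positivity)]
  linarith

lemma abs_exp_neg_mul_cosh_mul_le {x : ℝ} (hx : 0 < x) {f : ℝ → ℝ} {A : ℝ} {n : ℕ}
    (hf : ∀ t, |f t| ≤ A * Real.cosh t ^ n) (t : ℝ) :
    |Real.exp (-x * Real.cosh t) * f t| ≤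
      A * (2 * ((n + 1).factorial / x ^ (n + 1))) * Real.exp (-t) := by
  have hA : 0 ≤ A := by
    have := (abs_nonneg _).trans (hf 0)
    simpa using this
  rw [abs_mul, abs_of_pos (Real.exp_pos _)]
  calc _ ≤ Real.exp (-x * Real.cosh t) * (A * Real.cosh t ^ n) := by gcongr; exact hf t
    _ = A * (Real.exp (-x * Real.cosh t) * Real.cosh t ^ n) := by ring
    _ ≤ A * (2 * ((n + 1).factorial / x ^ (n + 1)) * Real.exp (-t)) := by
        exact mul_le_mul_of_nonneg_left (cosh_pow_mul_exp_neg_le hx n t) hA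
    _ = _ := by ring

lemma integrableOn_exp_neg_mul_cosh_mul {x : ℝ} (hx : 0 < x) {f : ℝ → ℝ} (hc : Continuous f)
    {A : ℝ} {n : ℕ} (hf : ∀ t, |f t| ≤ A * Real.cosh t ^ n) :
    IntegrableOn (fun t => Real.exp (-x * Real.cosh t) * f t) (Ioi 0) := by
  have hi : IntegrableOn (fun t : ℝ => Real.exp (-t)) (Ioi 0) := by
    simpa using exp_neg_integrableOn_Ioi 0 one_pos
  refine Integrable.mono' (hi.const_mul (A * (2 * ((n + 1).factorial / x ^ (n + 1)))))
    (Continuous.aestronglyMeasurable (by fun_prop)) (Eventually.of_forall fun t => ?_)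
  exact abs_exp_neg_mul_cosh_mul_le hx hf t

lemma tendsto_exp_neg_mul_cosh_mul {x : ℝ} (hx : 0 < x) {f : ℝ → ℝ}
    {A : ℝ} {n : ℕ} (hf : ∀ t, |f t| ≤ A * Real.cosh t ^ n) :
    Tendsto (fun t => Real.exp (-x * Real.cosh t) * f t) atTop (𝓝 0) := by
  refine squeeze_zero_norm (fun t => abs_exp_neg_mul_cosh_mul_le hx hf t) ?_
  simpa using (Real.tendsto_exp_neg_atTop_nhds_zero).const_mul
    (A * (2 * ((n + 1).factorial / x ^ (n + 1))))

/-- Integration by parts against the weight `exp (-x cosh t)` on the half-line, for a function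
vanishing at `0`. -/
lemma integral_exp_neg_mul_cosh_by_parts {x : ℝ} (hx : 0 < x) {f f' : ℝ → ℝ}
    (hd : ∀ t, HasDerivAt f (f' t) t) (hc' : Continuous f') (h0 : f 0 = 0) {A B : ℝ} {m n : ℕ}
    (hf : ∀ t, |f t| ≤ A * Real.cosh t ^ m) (hf' : ∀ t, |f' t| ≤ B * Real.cosh t ^ n) :
    ∫ t in Ioi (0 : ℝ), Real.exp (-x * Real.cosh t) * f' t =
      ∫ t in Ioi (0 : ℝ), Real.exp (-x * Real.cosh t) * (x * Real.sinh t * f t) := by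
  have hc : Continuous f := continuous_iff_continuousAt.2 fun t => (hd t).continuousAt
  have hi' := integrableOn_exp_neg_mul_cosh_mul hx hc' hf'
  have hi : IntegrableOn (fun t => Real.exp (-x * Real.cosh t) * (x * Real.sinh t * f t))
      (Ioi 0) := by
    refine integrableOn_exp_neg_mul_cosh_mul hx (A := x * A) (n := m + 1) (by fun_prop) fun t => ?_
    calc |x * Real.sinh t * f t| = x * |Real.sinh t| * |f t| := by
          rw [abs_mul, abs_mul, abs_of_pos hx]
      _ ≤ x * Real.cosh t * (A * Real.cosh t ^ m) := by
          have := Real.cosh_pos t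
          gcongr
          exacts [abs_sinh_le_cosh t, hf t]
      _ = _ := by ring
  have hD : ∀ t, HasDerivAt (fun t => Real.exp (-x * Real.cosh t) * f t)
      (Real.exp (-x * Real.cosh t) * f' t -
        Real.exp (-x * Real.cosh t) * (x * Real.sinh t * f t)) t := fun t => by
    have h := (((Real.hasDerivAt_cosh t).const_mul (-x)).exp).mul (hd t)
    refine h.congr_deriv ?_
    ring
  have key := integral_Ioi_of_hasDerivAt_of_tendsto' (a := (0 : ℝ)) (fun t _ => hD t)
    (hi'.sub hi) (tendsto_exp_neg_mul_cosh_mul hx hf)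
  rw [integral_sub hi' hi] at key
  simp only [h0] at key
  linarith

end CoshWeight

section Moments

/-- The function `(-1)ⁿ` times the `n`-th derivative of the modified Bessel function `K_v`. -/
noncomputable def besselMoment (v : ℝ) (n : ℕ) (x : ℝ) : ℝ :=
  ∫ t in Ioi (0 : ℝ), Real.exp (-x * Real.cosh t) * (Real.cosh t ^ n * Real.cosh (v * t))

variable {v x : ℝ}

lemma cosh_mul_le_cosh (hv0 : 0 ≤ v) (hv1 : v ≤ 1) (t : ℝ) :
    Real.cosh (v * t) ≤ Real.cosh t := by
  rw [Real.cosh_le_cosh, abs_mul, abs_of_nonneg hv0]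
  nlinarith [abs_nonneg t]

lemma abs_cosh_pow_mul_cosh_le (hv0 : 0 ≤ v) (hv1 : v ≤ 1) (n : ℕ) (t : ℝ) :
    |Real.cosh t ^ n * Real.cosh (v * t)| ≤ 1 * Real.cosh t ^ (n + 1) := by
  have h1 := Real.cosh_pos t
  have h2 := Real.cosh_pos (v * t)
  rw [abs_of_pos (by positivity), one_mul, pow_succ]
  gcongr
  exact cosh_mul_le_cosh hv0 hv1 t

lemma integrableOn_besselMoment (hv0 : 0 ≤ v) (hv1 : v ≤ 1) (n : ℕ) (hx : 0 < x) :
    IntegrableOn (fun t => Real.exp (-x * Real.cosh t) * (Real.cosh t ^ n * Real.cosh (v * t)))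
      (Ioi 0) :=
  integrableOn_exp_neg_mul_cosh_mul hx (by fun_prop) (abs_cosh_pow_mul_cosh_le hv0 hv1 n)

lemma integral_Ioi_pos_of_pos {f : ℝ → ℝ} (hi : IntegrableOn f (Ioi 0))
    (hf : ∀ t, 0 < t → 0 < f t) : 0 < ∫ t in Ioi (0 : ℝ), f t := by
  rw [setIntegral_pos_iff_support_of_nonneg_ae _ hi]
  · have : Function.support f ∩ Ioi 0 = Ioi 0 :=
      inter_eq_right.2 fun t ht => (hf t ht).ne'
    rw [this]
    simp
  · exact (ae_restrict_iff' measurableSet_Ioi).2 (Eventually.of_forall fun t ht => (hf t ht).le)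

lemma besselMoment_pos (hv0 : 0 ≤ v) (hv1 : v ≤ 1) (n : ℕ) (hx : 0 < x) :
    0 < besselMoment v n x :=
  integral_Ioi_pos_of_pos (integrableOn_besselMoment hv0 hv1 n hx) fun t _ => by
    have h1 := Real.cosh_pos t
    have h2 := Real.cosh_pos (v * t)
    positivity

lemma hasDerivAt_besselMoment (hv0 : 0 ≤ v) (hv1 : v ≤ 1) (n : ℕ) (hx : 0 < x) :
    HasDerivAt (besselMoment v n) (-besselMoment v (n + 1) x) x := by
  have h := hasDerivAt_integral_of_dominated_loc_of_deriv_le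
    (μ := volume.restrict (Ioi (0 : ℝ))) (s := Ioi (x / 2)) (x₀ := x)
    (F := fun y t => Real.exp (-y * Real.cosh t) * (Real.cosh t ^ n * Real.cosh (v * t)))
    (F' := fun y t => -(Real.exp (-y * Real.cosh t) *
      (Real.cosh t ^ (n + 1) * Real.cosh (v * t))))
    (bound := fun t => Real.exp (-(x / 2) * Real.cosh t) *
      (Real.cosh t ^ (n + 1) * Real.cosh (v * t)))
    (Ioi_mem_nhds (by linarith))
    (Eventually.of_forall fun y => Continuous.aestronglyMeasurable (by fun_prop))
    (integrableOn_besselMoment hv0 hv1 n hx)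
    (Continuous.aestronglyMeasurable (by fun_prop))
    (Eventually.of_forall fun t y hy => ?_)
    (integrableOn_besselMoment hv0 hv1 (n + 1) (half_pos hx))
    (Eventually.of_forall fun t y _ => ?_)
  · have h2 := h.2
    rw [integral_neg] at h2
    exact h2
  · have h1 := Real.cosh_pos t
    have h2 := Real.cosh_pos (v * t)
    have hy' : x / 2 < y := hy
    rw [norm_neg, Real.norm_of_nonneg (by positivity)]
    gcongr
  · have h := (((hasDerivAt_id y).neg.mul_const (Real.cosh t)).exp).mul_const
      (Real.cosh t ^ n * Real.cosh (v * t))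
    refine h.congr_deriv ?_
    simp only [id, Pi.neg_apply]
    ring

/-- The modified Bessel differential equation. -/
lemma besselMoment_ode (hv0 : 0 ≤ v) (hv1 : v ≤ 1) (hx : 0 < x) :
    x ^ 2 * besselMoment v 2 x =
      (x ^ 2 + v ^ 2) * besselMoment v 0 x + x * besselMoment v 1 x := by
  have i0 := integrableOn_besselMoment hv0 hv1 0 hx
  have i1 := integrableOn_besselMoment hv0 hv1 1 hx
  have i2 := integrableOn_besselMoment hv0 hv1 2 hx
  have hlin : ∀ t : ℝ, HasDerivAt (fun t => v * t) v t := fun t => by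
    simpa using (hasDerivAt_id t).const_mul v
  have hsv : ∀ t, |Real.sinh (v * t)| ≤ Real.cosh t := fun t =>
    (abs_sinh_le_cosh _).trans (cosh_mul_le_cosh hv0 hv1 t)
  have hcv : ∀ t, |Real.cosh (v * t)| ≤ Real.cosh t := fun t => by
    rw [abs_of_pos (Real.cosh_pos _)]
    exact cosh_mul_le_cosh hv0 hv1 t
  have hprod : ∀ a b c : ℝ, |a| ≤ c → |b| ≤ c → |a * b| ≤ c ^ 2 := fun a b c ha hb => by
    rw [abs_mul, sq]
    exact mul_le_mul ha hb (abs_nonneg _) ((abs_nonneg _).trans ha)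
  have hcc : ∀ t, |Real.cosh t| ≤ Real.cosh t := fun t => (abs_of_pos (Real.cosh_pos t)).le
  have h1le : ∀ t, Real.cosh t ≤ Real.cosh t ^ 2 := fun t => by nlinarith [Real.one_le_cosh t]
  have key := integral_exp_neg_mul_cosh_by_parts hx
    (f := fun t => x * (Real.sinh t * Real.cosh (v * t)) + v * Real.sinh (v * t))
    (f' := fun t => x * (Real.cosh t * Real.cosh (v * t)) +
      (x * v) * (Real.sinh t * Real.sinh (v * t)) + v ^ 2 * Real.cosh (v * t))
    (A := x + v) (B := x + x * v + v ^ 2) (m := 2) (n := 2)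
    (fun t => by
      refine ((((Real.hasDerivAt_sinh t).mul (hlin t).cosh).const_mul x).add
        ((hlin t).sinh.const_mul v)).congr_deriv ?_
      ring)
    (by fun_prop) (by simp)
    (fun t => by
      have e1 := hprod _ _ _ (abs_sinh_le_cosh t) (hcv t)
      have e2 := (hsv t).trans (h1le t)
      calc _ ≤ |x * (Real.sinh t * Real.cosh (v * t))| + |v * Real.sinh (v * t)| := abs_add_le _ _
        _ = x * |Real.sinh t * Real.cosh (v * t)| + v * |Real.sinh (v * t)| := by
          rw [abs_mul x, abs_mul v, abs_of_pos hx, abs_of_nonneg hv0]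
        _ ≤ x * Real.cosh t ^ 2 + v * Real.cosh t ^ 2 := by gcongr
        _ = _ := by ring)
    (fun t => by
      have e1 := hprod _ _ _ (hcc t) (hcv t)
      have e2 := hprod _ _ _ (abs_sinh_le_cosh t) (hsv t)
      have e3 := (hcv t).trans (h1le t)
      calc _ ≤ |x * (Real.cosh t * Real.cosh (v * t))| +
            |(x * v) * (Real.sinh t * Real.sinh (v * t))| + |v ^ 2 * Real.cosh (v * t)| :=
          abs_add_three _ _ _
        _ = x * |Real.cosh t * Real.cosh (v * t)| +
            (x * v) * |Real.sinh t * Real.sinh (v * t)| + v ^ 2 * |Real.cosh (v * t)| := by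
          rw [abs_mul x, abs_mul (x * v), abs_mul (v ^ 2), abs_of_pos hx,
            abs_of_nonneg (mul_nonneg hx.le hv0), abs_of_nonneg (sq_nonneg v)]
        _ ≤ x * Real.cosh t ^ 2 + (x * v) * Real.cosh t ^ 2 + v ^ 2 * Real.cosh t ^ 2 := by
          gcongr
        _ = _ := by ring)
  have i3 : IntegrableOn (fun t => Real.exp (-x * Real.cosh t) *
      (Real.sinh t * Real.sinh (v * t))) (Ioi 0) :=
    integrableOn_exp_neg_mul_cosh_mul hx (A := 1) (n := 2) (by fun_prop)
      fun t => by simpa using hprod _ _ _ (abs_sinh_le_cosh t) (hsv t)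
  have e1 : ∫ t in Ioi (0 : ℝ), Real.exp (-x * Real.cosh t) *
      (x * (Real.cosh t * Real.cosh (v * t)) +
      (x * v) * (Real.sinh t * Real.sinh (v * t)) + v ^ 2 * Real.cosh (v * t)) =
      x * besselMoment v 1 x + (x * v) * (∫ t in Ioi (0 : ℝ), Real.exp (-x * Real.cosh t) *
      (Real.sinh t * Real.sinh (v * t))) + v ^ 2 * besselMoment v 0 x := by
    unfold besselMoment
    rw [← integral_const_mul, ← integral_const_mul, ← integral_const_mul,
      ← integral_add (i1.const_mul _) (i3.const_mul _)]
    refine Eq.trans ?_ (integral_add ((i1.const_mul x).add (i3.const_mul (x * v)))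
      (i0.const_mul (v ^ 2)))
    congr 1
    ext t
    ring
  have e2 : ∫ t in Ioi (0 : ℝ), Real.exp (-x * Real.cosh t) *
      (x * Real.sinh t * (x * (Real.sinh t * Real.cosh (v * t)) + v * Real.sinh (v * t))) =
      x ^ 2 * besselMoment v 2 x - x ^ 2 * besselMoment v 0 x +
      (x * v) * (∫ t in Ioi (0 : ℝ), Real.exp (-x * Real.cosh t) *
      (Real.sinh t * Real.sinh (v * t))) := by
    unfold besselMoment
    rw [← integral_const_mul, ← integral_const_mul, ← integral_const_mul,
      ← integral_sub (i2.const_mul _) (i0.const_mul _)]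
    refine Eq.trans ?_ (integral_add ((i2.const_mul (x ^ 2)).sub (i0.const_mul (x ^ 2)))
      (i3.const_mul (x * v)))
    congr 1
    ext t
    linear_combination
      (Real.exp (-x * Real.cosh t) * x ^ 2 * Real.cosh (v * t)) * Real.sinh_sq t
  rw [e1, e2] at key
  linarith

/-- Integration by parts with `tanh (t / 2) = sinh t / (cosh t + 1)`. -/
lemma besselMoment_one_sub_zero (hv0 : 0 ≤ v) (hv1 : v ≤ 1) (hx : 0 < x) :
    IntegrableOn (fun t => Real.exp (-x * Real.cosh t) * (Real.cosh (v * t) / (Real.cosh t + 1) +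
      v * (Real.sinh t / (Real.cosh t + 1)) * Real.sinh (v * t))) (Ioi 0) ∧
    x * (besselMoment v 1 x - besselMoment v 0 x) =
      ∫ t in Ioi (0 : ℝ), Real.exp (-x * Real.cosh t) * (Real.cosh (v * t) / (Real.cosh t + 1) +
        v * (Real.sinh t / (Real.cosh t + 1)) * Real.sinh (v * t)) := by
  have i0 := integrableOn_besselMoment hv0 hv1 0 hx
  have i1 := integrableOn_besselMoment hv0 hv1 1 hx
  have hlin : ∀ t : ℝ, HasDerivAt (fun t => v * t) v t := fun t => by
    simpa using (hasDerivAt_id t).const_mul v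
  have hne : ∀ t, Real.cosh t + 1 ≠ 0 := fun t => by linarith [Real.cosh_pos t]
  have hT : ∀ t, |Real.sinh t / (Real.cosh t + 1)| ≤ 1 := fun t => by
    have := Real.cosh_pos t
    rw [abs_div, abs_of_pos (by linarith : 0 < Real.cosh t + 1), div_le_one (by linarith)]
    linarith [abs_sinh_le_cosh t]
  have hb : ∀ t, |Real.cosh (v * t) / (Real.cosh t + 1) +
      v * (Real.sinh t / (Real.cosh t + 1)) * Real.sinh (v * t)| ≤
      2 * Real.cosh t ^ 1 := fun t => by
    have hc := Real.cosh_pos t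
    have hc' := Real.cosh_pos (v * t)
    have hle := cosh_mul_le_cosh hv0 hv1 t
    have a1 : |Real.cosh (v * t) / (Real.cosh t + 1)| ≤ Real.cosh t := by
      rw [abs_of_pos (by positivity)]
      exact (div_le_self hc'.le (by linarith)).trans hle
    have a2 : |v * (Real.sinh t / (Real.cosh t + 1)) * Real.sinh (v * t)| ≤ Real.cosh t := by
      rw [abs_mul, abs_mul, abs_of_nonneg hv0]
      have : v * |Real.sinh t / (Real.cosh t + 1)| ≤ 1 :=
        mul_le_one₀ hv1 (abs_nonneg _) (hT t)
      calc _ ≤ 1 * |Real.sinh (v * t)| := by gcongr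
        _ ≤ _ := by rw [one_mul]; exact (abs_sinh_le_cosh _).trans hle
    linarith [abs_add_le (Real.cosh (v * t) / (Real.cosh t + 1))
      (v * (Real.sinh t / (Real.cosh t + 1)) * Real.sinh (v * t))]
  have hcont : Continuous fun t => Real.cosh (v * t) / (Real.cosh t + 1) +
      v * (Real.sinh t / (Real.cosh t + 1)) * Real.sinh (v * t) := by
    fun_prop (disch := exact hne _)
  refine ⟨integrableOn_exp_neg_mul_cosh_mul hx hcont hb, ?_⟩
  rw [integral_exp_neg_mul_cosh_by_parts hx
    (f := fun t => Real.sinh t / (Real.cosh t + 1) * Real.cosh (v * t))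
    (A := 1) (m := 1) (fun t => ?_) hcont (by simp) (fun t => ?_) hb]
  · unfold besselMoment
    rw [← integral_sub i1 i0, ← integral_const_mul]
    congr 1
    ext t
    have := hne t
    field_simp
    linear_combination -Real.sinh_sq t
  · refine (((Real.hasDerivAt_sinh t).div ((Real.hasDerivAt_cosh t).add_const 1) (hne t)).mul
      (hlin t).cosh).congr_deriv ?_
    have := hne t
    simp only [Pi.div_apply]
    field_simp
    linear_combination (-Real.cosh (v * t)) * Real.sinh_sq t
  · rw [abs_mul, abs_of_pos (Real.cosh_pos (v * t)), pow_one]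
    exact mul_le_mul (hT t) (cosh_mul_le_cosh hv0 hv1 t) (Real.cosh_pos _).le zero_le_one

lemma two_mul_mul_sinh_lt (hv0 : 0 ≤ v) (hv : v < 1 / 2) {t : ℝ} (ht : 0 < t) :
    2 * v * (Real.cosh t + 1) * Real.sinh (v * t) < Real.sinh t * Real.cosh (v * t) := by
  have h1 : 0 < Real.sinh (t / 2 - v * t) := Real.sinh_pos_iff.2 (by nlinarith)
  rw [Real.sinh_sub] at h1
  have h2 : 0 ≤ Real.sinh (v * t) := Real.sinh_nonneg_iff.2 (by positivity)
  have h3 := Real.cosh_pos (t / 2)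
  have h4 : Real.cosh t = 2 * Real.cosh (t / 2) ^ 2 - 1 := by
    rw [show t = 2 * (t / 2) by ring, Real.cosh_two_mul, Real.sinh_sq]; ring_nf
  have h5 : Real.sinh t = 2 * Real.sinh (t / 2) * Real.cosh (t / 2) := by
    rw [← Real.sinh_two_mul]; ring_nf
  rw [h4, h5]
  have h6 : 2 * v * (Real.cosh (t / 2) * Real.sinh (v * t)) ≤
      1 * (Real.cosh (t / 2) * Real.sinh (v * t)) := by gcongr; linarith
  nlinarith

lemma besselMoment_zero_half_sub (hv0 : 0 ≤ v) (hv : v < 1 / 2) (hx : 0 < x) :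
    0 < besselMoment v 0 x / 2 - x * (besselMoment v 1 x - besselMoment v 0 x) ∧
    besselMoment v 0 x / 2 - x * (besselMoment v 1 x - besselMoment v 0 x) ≤
      (besselMoment v 1 x - besselMoment v 0 x) / 4 := by
  have hv1 : v ≤ 1 := by linarith
  have i0 := integrableOn_besselMoment hv0 hv1 0 hx
  have i1 := integrableOn_besselMoment hv0 hv1 1 hx
  obtain ⟨i, e⟩ := besselMoment_one_sub_zero hv0 hv1 hx
  have e' : besselMoment v 0 x / 2 - x * (besselMoment v 1 x - besselMoment v 0 x) =
      ∫ t in Ioi (0 : ℝ), (Real.exp (-x * Real.cosh t) * (Real.cosh t ^ 0 * Real.cosh (v * t)) / 2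
        - Real.exp (-x * Real.cosh t) * (Real.cosh (v * t) / (Real.cosh t + 1) +
        v * (Real.sinh t / (Real.cosh t + 1)) * Real.sinh (v * t))) := by
    rw [e, integral_sub (i0.div_const 2) i, integral_div, besselMoment]
  have hpt : ∀ t, Real.exp (-x * Real.cosh t) * (Real.cosh t ^ 0 * Real.cosh (v * t)) / 2
        - Real.exp (-x * Real.cosh t) * (Real.cosh (v * t) / (Real.cosh t + 1) +
        v * (Real.sinh t / (Real.cosh t + 1)) * Real.sinh (v * t)) =
      Real.exp (-x * Real.cosh t) * (Real.sinh t / (2 * (Real.cosh t + 1) ^ 2)) *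
        (Real.sinh t * Real.cosh (v * t) - 2 * v * (Real.cosh t + 1) * Real.sinh (v * t)) := by
    intro t
    have : Real.cosh t + 1 ≠ 0 := by linarith [Real.cosh_pos t]
    field_simp
    linear_combination (-Real.cosh (v * t)) * Real.sinh_sq t
  rw [e']
  constructor
  · refine integral_Ioi_pos_of_pos ((i0.div_const 2).sub i) fun t ht => ?_
    rw [hpt]
    have h1 := Real.sinh_pos_iff.2 ht
    have h2 := Real.cosh_pos t
    have h3 := sub_pos.2 (two_mul_mul_sinh_lt hv0 hv ht)
    positivity
  · have e2 : (besselMoment v 1 x - besselMoment v 0 x) / 4 = ∫ t in Ioi (0 : ℝ),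
        (Real.exp (-x * Real.cosh t) * (Real.cosh t ^ 1 * Real.cosh (v * t)) -
        Real.exp (-x * Real.cosh t) * (Real.cosh t ^ 0 * Real.cosh (v * t))) / 4 := by
      rw [integral_div, integral_sub i1 i0, besselMoment, besselMoment]
    rw [e2]
    refine setIntegral_mono_on ((i0.div_const 2).sub i) ((i1.sub i0).div_const 4)
      measurableSet_Ioi fun t ht => ?_
    have ht : 0 < t := ht
    rw [hpt]
    have h1 := Real.sinh_pos_iff.2 ht
    have h2 := Real.one_le_cosh t
    have h3 : 0 ≤ Real.sinh (v * t) := Real.sinh_nonneg_iff.2 (by positivity)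
    have h4 := Real.cosh_pos (v * t)
    calc _ ≤ Real.exp (-x * Real.cosh t) * (Real.sinh t / (2 * (Real.cosh t + 1) ^ 2)) *
        (Real.sinh t * Real.cosh (v * t)) := by
          have : 0 ≤ 2 * v * (Real.cosh t + 1) * Real.sinh (v * t) := by positivity
          gcongr
          linarith
      _ = Real.exp (-x * Real.cosh t) * Real.cosh (v * t) *
          ((Real.cosh t - 1) / (2 * (Real.cosh t + 1))) := by
        have : Real.cosh t + 1 ≠ 0 := by linarith
        field_simp
        linear_combination Real.sinh_sq t
      _ ≤ Real.exp (-x * Real.cosh t) * Real.cosh (v * t) * ((Real.cosh t - 1) / 4) := by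
        have : 0 ≤ Real.cosh t - 1 := by linarith
        gcongr
        linarith
      _ = _ := by ring

lemma exists_abs_besselMoment_le (hv0 : 0 ≤ v) (hv : v < 1 / 2) :
    ∃ C : ℝ, ∀ x, 0 < x →
      |v * besselMoment v 0 x - x * (besselMoment v 1 x - besselMoment v 0 x)| ≤ C := by
  have hv1 : v ≤ 1 := by linarith
  have ih : IntegrableOn (fun t : ℝ => Real.exp (-(1 / 2) * t)) (Ioi 0) :=
    exp_neg_integrableOn_Ioi 0 (by norm_num)
  have iv : IntegrableOn (fun t : ℝ => v * Real.exp (-v * t)) (Ioi 0) := by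
    rcases hv0.eq_or_lt with rfl | hpos
    · simp
    · exact (exp_neg_integrableOn_Ioi 0 hpos).const_mul v
  refine ⟨∫ t in Ioi (0 : ℝ), ((2 + 4 * v) * Real.exp (-(1 / 2) * t) + v * Real.exp (-v * t)),
    fun x hx => ?_⟩
  have i0 := integrableOn_besselMoment hv0 hv1 0 hx
  obtain ⟨i, e⟩ := besselMoment_one_sub_zero hv0 hv1 hx
  rw [e, besselMoment, ← integral_const_mul, ← integral_sub (i0.const_mul v) i, ← Real.norm_eq_abs]
  refine norm_integral_le_of_norm_le ((ih.const_mul _).add iv)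
    ((ae_restrict_iff' measurableSet_Ioi).2 (Eventually.of_forall fun t ht => ?_))
  have ht : 0 < t := ht
  have hc1 := Real.one_le_cosh t
  have hs := Real.sinh_pos_iff.2 ht
  have hsv : 0 ≤ Real.sinh (v * t) := Real.sinh_nonneg_iff.2 (by positivity)
  have hcv := Real.cosh_pos (v * t)
  have hne : Real.cosh t + 1 ≠ 0 := by linarith
  have hsub : Real.cosh (v * t) = Real.exp (-v * t) + Real.sinh (v * t) := by
    rw [neg_mul, ← Real.cosh_sub_sinh]; ring
  have hct : Real.cosh t - Real.sinh t ≤ 1 := by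
    rw [Real.cosh_sub_sinh]
    exact Real.exp_le_one_iff.2 (by linarith)
  have hcs : 0 < Real.cosh t - Real.sinh t := by
    rw [Real.cosh_sub_sinh]
    exact Real.exp_pos _
  have hinv : 1 / (Real.cosh t + 1) ≤ 2 * Real.exp (-t) := by
    rw [div_le_iff₀ (by linarith), Real.cosh_eq]
    have : Real.exp (-t) * Real.exp t = 1 := by rw [← Real.exp_add]; simp
    nlinarith [Real.exp_pos (-t)]
  have hgrow : Real.cosh (v * t) ≤ Real.exp (t / 2) := by
    have a1 : Real.exp (v * t) ≤ Real.exp (t / 2) := Real.exp_le_exp.2 (by nlinarith)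
    have a2 : Real.exp (-(v * t)) ≤ Real.exp (t / 2) := Real.exp_le_exp.2 (by nlinarith)
    rw [Real.cosh_eq]
    linarith
  have hexp : Real.exp (-t) * Real.exp (t / 2) = Real.exp (-(1 / 2) * t) := by
    rw [← Real.exp_add]; ring_nf
  have hcq : Real.cosh (v * t) * (1 / (Real.cosh t + 1)) ≤ 2 * Real.exp (-(1 / 2) * t) := by
    calc _ ≤ Real.exp (t / 2) * (2 * Real.exp (-t)) := by gcongr
      _ = _ := by rw [← hexp]; ring
  have hcq0 : 0 < Real.cosh (v * t) * (1 / (Real.cosh t + 1)) := by positivity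
  set q := Real.cosh (v * t) * (1 / (Real.cosh t + 1)) with hq
  have hw : Real.exp (-x * Real.cosh t) ≤ 1 := Real.exp_le_one_iff.2 (by nlinarith)
  have hS0 : 0 ≤ (1 - Real.sinh t / (Real.cosh t + 1)) * Real.sinh (v * t) := by
    refine mul_nonneg ?_ hsv
    rw [sub_nonneg, div_le_one (by linarith)]
    linarith
  have hS : (1 - Real.sinh t / (Real.cosh t + 1)) * Real.sinh (v * t) ≤ 2 * q := by
    have : 1 - Real.sinh t / (Real.cosh t + 1) =
        (Real.cosh t - Real.sinh t + 1) * (1 / (Real.cosh t + 1)) := by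
      field_simp
      ring
    rw [this, hq]
    calc _ ≤ 2 * (1 / (Real.cosh t + 1)) * Real.cosh (v * t) := by
          gcongr
          · linarith
          · exact (Real.sinh_lt_cosh _).le
      _ = _ := by ring
  have heq : v * (Real.exp (-x * Real.cosh t) * (Real.cosh t ^ 0 * Real.cosh (v * t))) -
      Real.exp (-x * Real.cosh t) * (Real.cosh (v * t) / (Real.cosh t + 1) +
        v * (Real.sinh t / (Real.cosh t + 1)) * Real.sinh (v * t)) =
      Real.exp (-x * Real.cosh t) * (v * (Real.exp (-v * t) +
        (1 - Real.sinh t / (Real.cosh t + 1)) * Real.sinh (v * t)) - q) := by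
    linear_combination (v * Real.exp (-x * Real.cosh t)) * hsub
  rw [heq, norm_mul, Real.norm_of_nonneg (Real.exp_pos _).le]
  set S := (1 - Real.sinh t / (Real.cosh t + 1)) * Real.sinh (v * t)
  have hE := Real.exp_pos (-v * t)
  have hvS : v * S ≤ v * (4 * Real.exp (-(1 / 2) * t)) := by gcongr; linarith
  have hvS0 : 0 ≤ v * S := by positivity
  have hvE : 0 ≤ v * Real.exp (-v * t) := by positivity
  calc _ ≤ 1 * ‖v * (Real.exp (-v * t) + S) - q‖ := by gcongr
    _ ≤ _ := by
      rw [one_mul, Real.norm_eq_abs, abs_le]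
      constructor <;> nlinarith

lemma tendsto_besselMoment_zero_atTop (hv0 : 0 ≤ v) (hv1 : v ≤ 1) :
    Tendsto (besselMoment v 0) (𝓝[>] 0) atTop := by
  refine tendsto_atTop.2 fun A => ?_
  set B := |A| + 1 with hB
  have hBpos : 0 < B := by positivity
  have hlim : Tendsto (fun x => Real.exp (-x * Real.cosh B) * B) (𝓝[>] 0) (𝓝 B) := by
    have : Continuous fun x => Real.exp (-x * Real.cosh B) * B := by fun_prop
    have h := this.tendsto 0
    simp only [neg_zero, zero_mul, Real.exp_zero, one_mul] at h
    exact h.mono_left nhdsWithin_le_nhds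
  filter_upwards [hlim.eventually (lt_mem_nhds (show A < B by linarith [le_abs_self A])),
    self_mem_nhdsWithin] with x hA hx
  have hx : 0 < x := hx
  refine hA.le.trans ?_
  have i0 := integrableOn_besselMoment hv0 hv1 0 hx
  calc Real.exp (-x * Real.cosh B) * B = ∫ t in Ioc 0 B, Real.exp (-x * Real.cosh B) := by
        simp [hBpos.le, mul_comm]
    _ ≤ ∫ t in Ioc 0 B, Real.exp (-x * Real.cosh t) * (Real.cosh t ^ 0 * Real.cosh (v * t)) := by
        refine setIntegral_mono_on (by simp) (i0.mono_set Ioc_subset_Ioi_self)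
          measurableSet_Ioc fun t ht => ?_
        have h1 : Real.cosh t ≤ Real.cosh B := by
          rw [Real.cosh_le_cosh, abs_of_pos ht.1, abs_of_pos hBpos]
          exact ht.2
        have h2 := Real.one_le_cosh (v * t)
        have h3 : Real.exp (-x * Real.cosh B) ≤ Real.exp (-x * Real.cosh t) :=
          Real.exp_le_exp.2 (by nlinarith)
        rw [pow_zero, one_mul]
        nlinarith [Real.exp_pos (-x * Real.cosh t)]
    _ ≤ _ := by
        refine setIntegral_mono_set i0 (Eventually.of_forall fun t => ?_)
          Ioc_subset_Ioi_self.eventuallyLE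
        have := Real.cosh_pos (v * t)
        have := Real.cosh_pos t
        simp only [Pi.zero_apply]
        positivity

lemma besselMoment_zero_le (hv0 : 0 ≤ v) (hv1 : v ≤ 1) (hx : 1 ≤ x) :
    besselMoment v 0 x ≤ Real.exp (1 - x) * besselMoment v 0 1 := by
  unfold besselMoment
  rw [← integral_const_mul]
  refine setIntegral_mono_on (integrableOn_besselMoment hv0 hv1 0 (by linarith))
    ((integrableOn_besselMoment hv0 hv1 0 one_pos).const_mul _) measurableSet_Ioi fun t _ => ?_
  have h1 := Real.one_le_cosh t
  have h2 := Real.cosh_pos (v * t)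
  rw [← mul_assoc (Real.exp (1 - x)), ← Real.exp_add]
  gcongr
  nlinarith

/-- `x K(x)² Λ'(x)`, written through the moments, is negative. -/
lemma besselMoment_wronskian_neg (hv0 : 0 ≤ v) (hv : v < 1 / 2) (hx : 0 < x) :
    (x + x ^ 2 + v ^ 2) * besselMoment v 0 x ^ 2 - x ^ 2 * besselMoment v 1 x ^ 2 < 0 := by
  have hv1 : v ≤ 1 := by linarith
  set Q : ℝ → ℝ := fun x =>
    (x + x ^ 2 + v ^ 2) * besselMoment v 0 x ^ 2 - x ^ 2 * besselMoment v 1 x ^ 2 with hQ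
  have hd : ∀ y, 0 < y → HasDerivAt Q (2 * besselMoment v 0 y *
      (besselMoment v 0 y / 2 - y * (besselMoment v 1 y - besselMoment v 0 y))) y := by
    intro y hy
    have h0 := hasDerivAt_besselMoment hv0 hv1 0 hy
    have h1 := hasDerivAt_besselMoment hv0 hv1 1 hy
    have hp : HasDerivAt (fun x : ℝ => x + x ^ 2 + v ^ 2) (1 + 2 * y) y := by
      simpa using ((hasDerivAt_id y).add (hasDerivAt_pow 2 y)).add_const (v ^ 2)
    refine ((hp.mul (h0.pow 2)).sub ((hasDerivAt_pow 2 y).mul (h1.pow 2))).congr_deriv ?_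
    simp only [Pi.pow_apply]
    norm_num
    linear_combination (2 * besselMoment v 1 y) * besselMoment_ode hv0 hv1 hy
  have hmono : StrictMonoOn Q (Ioi 0) := by
    refine strictMonoOn_of_deriv_pos (convex_Ioi 0)
      (fun y hy => (hd y hy).continuousAt.continuousWithinAt) fun y hy => ?_
    rw [interior_Ioi] at hy
    rw [(hd y hy).deriv]
    have h1 := besselMoment_pos hv0 hv1 0 hy
    have h2 := (besselMoment_zero_half_sub hv0 hv hy).1
    positivity
  have hle : ∀ y, 0 < y → Q y ≤ 0 := by
    intro y hy
    have hlim : Tendsto (fun z : ℝ => 3 * (besselMoment v 0 1 * Real.exp 1) ^ 2 *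
        (z ^ 1 * Real.exp (-z)) ^ 2) atTop (𝓝 0) := by
      simpa using ((Real.tendsto_pow_mul_exp_neg_atTop_nhds_zero 1).pow 2).const_mul
        (3 * (besselMoment v 0 1 * Real.exp 1) ^ 2)
    refine ge_of_tendsto hlim ?_
    filter_upwards [eventually_ge_atTop 1, eventually_ge_atTop y] with z hz hyz
    have hz0 : 0 < z := by linarith
    have hM := besselMoment_pos hv0 hv1 0 hz0
    calc Q y ≤ Q z := hmono.monotoneOn hy hz0 hyz
      _ ≤ (z + z ^ 2 + v ^ 2) * besselMoment v 0 z ^ 2 := by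
          simp only [hQ]
          nlinarith [sq_nonneg (z * besselMoment v 1 z)]
      _ ≤ (3 * z ^ 2) * (Real.exp (1 - z) * besselMoment v 0 1) ^ 2 := by
          gcongr
          · nlinarith
          · exact besselMoment_zero_le hv0 hv1 hz
      _ = _ := by
          rw [sub_eq_add_neg, Real.exp_add]
          ring
  exact (hmono hx (show x + 1 ∈ Ioi 0 by simp only [mem_Ioi]; linarith) (by linarith)).trans_le
    (hle (x + 1) (by linarith))

end Moments

theorem stmt_15 (v : ℝ) (hv0 : 0 ≤ v) (hv : v < 1 / 2)
    (K : ℝ → ℝ)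
    (hK : ∀ x, K x = ∫ t in Ioi (0 : ℝ), Real.exp (-x * Real.cosh t) * Real.cosh (v * t)) :
    StrictAntiOn (fun x => x + x * deriv K x / K x) (Ioi 0) ∧
    Tendsto (fun x => x + x * deriv K x / K x) (𝓝[>] (0 : ℝ)) (𝓝 (-v)) ∧
    Tendsto (fun x => x + x * deriv K x / K x) atTop (𝓝 (-(1 / 2))) ∧
    ∀ x > (0 : ℝ), -(1 / 2) < x + x * deriv K x / K x ∧ x + x * deriv K x / K x < -v := by
  have hv1 : v ≤ 1 := by linarith
  obtain rfl : K = besselMoment v 0 := by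
    ext x
    simp [hK, besselMoment]
  set L : ℝ → ℝ := fun x => x + x * deriv (besselMoment v 0) x / besselMoment v 0 x with hLdef
  have hpos : ∀ x, 0 < x → 0 < besselMoment v 0 x := fun x => besselMoment_pos hv0 hv1 0
  have hL : ∀ x, 0 < x → L x = x - x * besselMoment v 1 x / besselMoment v 0 x := by
    intro x hx
    simp only [hLdef, (hasDerivAt_besselMoment hv0 hv1 0 hx).deriv]
    ring
  have hd : ∀ x, 0 < x → HasDerivAt L (((x + x ^ 2 + v ^ 2) * besselMoment v 0 x ^ 2 -
      x ^ 2 * besselMoment v 1 x ^ 2) / (x * besselMoment v 0 x ^ 2)) x := by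
    intro x hx
    have h0 := hasDerivAt_besselMoment hv0 hv1 0 hx
    have h1 := hasDerivAt_besselMoment hv0 hv1 1 hx
    have hne := (hpos x hx).ne'
    have h := (hasDerivAt_id x).sub (((hasDerivAt_id x).mul h1).div h0 hne)
    refine (h.congr_deriv ?_).congr_of_eventuallyEq ?_
    · simp only [id, Pi.mul_apply]
      have hx' := hx.ne'
      field_simp
      norm_num
      linear_combination besselMoment v 0 x * besselMoment_ode hv0 hv1 hx
    · filter_upwards [Ioi_mem_nhds hx] with y hy
      rw [hL y hy]
      simp
  have hanti : StrictAntiOn L (Ioi 0) := by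
    refine strictAntiOn_of_deriv_neg (convex_Ioi 0)
      (fun y hy => (hd y hy).continuousAt.continuousWithinAt) fun y hy => ?_
    rw [interior_Ioi] at hy
    rw [(hd y hy).deriv]
    have hy : 0 < y := hy
    have := hpos y hy
    exact div_neg_of_neg_of_pos (besselMoment_wronskian_neg hv0 hv hy) (by positivity)
  have hlow : ∀ x, 0 < x → -(1 / 2) < L x ∧ L x ≤ -(1 / 2) + 1 / 8 * x⁻¹ := by
    intro x hx
    obtain ⟨h1, h2⟩ := besselMoment_zero_half_sub hv0 hv hx
    have h0 := hpos x hx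
    have e : L x + 1 / 2 = (besselMoment v 0 x / 2 -
        x * (besselMoment v 1 x - besselMoment v 0 x)) / besselMoment v 0 x := by
      rw [hL x hx]
      field_simp
      ring
    constructor
    · have := div_pos h1 h0
      linarith
    · have : (besselMoment v 0 x / 2 -
          x * (besselMoment v 1 x - besselMoment v 0 x)) / besselMoment v 0 x ≤ 1 / 8 * x⁻¹ := by
        rw [div_le_iff₀ h0, ← div_eq_mul_inv, div_mul_eq_mul_div, le_div_iff₀ hx]
        nlinarith
      linarith
  have hzero : Tendsto L (𝓝[>] 0) (𝓝 (-v)) := by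
    obtain ⟨C, hC⟩ := exists_abs_besselMoment_le hv0 hv
    rw [tendsto_iff_norm_sub_tendsto_zero]
    refine squeeze_zero' (Eventually.of_forall fun _ => norm_nonneg _) ?_
      ((tendsto_besselMoment_zero_atTop hv0 hv1).const_div_atTop C)
    filter_upwards [self_mem_nhdsWithin] with x hx
    have hx : 0 < x := hx
    have h0 := hpos x hx
    have e : L x - -v = (v * besselMoment v 0 x -
        x * (besselMoment v 1 x - besselMoment v 0 x)) / besselMoment v 0 x := by
      rw [hL x hx]
      field_simp
      ring
    rw [e, norm_div, Real.norm_of_nonneg h0.le]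
    gcongr
    exact hC x hx
  refine ⟨hanti, hzero, ?_, fun x hx => ⟨(hlow x hx).1, ?_⟩⟩
  · refine tendsto_of_tendsto_of_tendsto_of_le_of_le' tendsto_const_nhds
      (h := fun x => -(1 / 2) + 1 / 8 * x⁻¹) ?_ ?_ ?_
    · simpa only [mul_zero, add_zero] using
        (tendsto_inv_atTop_zero.const_mul (1 / 8 : ℝ)).const_add (-(1 / 2))
    · filter_upwards [eventually_gt_atTop 0] with x hx using (hlow x hx).1.le
    · filter_upwards [eventually_gt_atTop 0] with x hx using (hlow x hx).2
  · have hx2 : x / 2 ∈ Ioi 0 := half_pos hx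
    refine (hanti hx2 hx (half_lt_self hx)).trans_le (ge_of_tendsto hzero ?_)
    filter_upwards [Ioo_mem_nhdsGT (half_pos hx)] with y hy
    exact (hanti hy.1 hx2 hy.2).le
end

section
/- Let K_v(x) = ∫_0^∞ e^{−x·cosh t}·cosh(vt) dt for x > 0 and let P_λ(x) = (x + λ)·e^x·K_v(x) + x·e^x·K_v′(x). Then: (a) for v ≥ 1, P_λ is completely monotonic on (0,∞) if and only if λ ≥ v; (b) for 0 < v < 1/2, P_λ is completely monotonic on (0,∞) if and only if λ ≥ 1/2; (c) for v > 1/2, −P_λ is completely monotonic on (0,∞) if and only if λ ≤ 1/2. -/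
open Real Filter Set MeasureTheory Topology

/-- A function `F` is completely monotonic on `(0,∞)` if it is infinitely
differentiable there and `(−1)^n F^{(n)}(x) ≥ 0` for all `x > 0` and `n ≥ 0`. -/
def CompletelyMonotonicOn (F : ℝ → ℝ) : Prop :=
  ContDiffOn ℝ (⊤ : ℕ∞) F (Ioi 0) ∧
    ∀ (n : ℕ) (x : ℝ), 0 < x → 0 ≤ (-1) ^ n * iteratedDeriv n F x


section LaplaceIntegral

variable {α : Type*} [MeasurableSpace α] {μ : Measure α} {u g : α → ℝ}

/-- The Laplace-type integral `∫ exp (-x u) g dμ` as a function of `x`. -/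
noncomputable def laplaceIntegral (μ : Measure α) (u g : α → ℝ) (x : ℝ) : ℝ :=
  ∫ a, Real.exp (-(x * u a)) * g a ∂μ

theorem laplaceIntegral_hasDerivAt (hu : Measurable u) (hu0 : ∀ a, 0 ≤ u a)
    (hg : ∀ x > 0, Integrable (fun a => Real.exp (-(x * u a)) * g a) μ) {x : ℝ} (hx : 0 < x) :
    Integrable (fun a => Real.exp (-(x * u a)) * (-u a * g a)) μ ∧
      HasDerivAt (laplaceIntegral μ u g) (laplaceIntegral μ u (fun a => -u a * g a) x) x := by
  have hgm : AEStronglyMeasurable g μ := by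
    have h := ((hu.exp).aestronglyMeasurable (μ := μ)).mul (hg 1 one_pos).aestronglyMeasurable
    refine h.congr (ae_of_all _ fun a => ?_)
    simp [← mul_assoc, ← Real.exp_add]
  have hm : ∀ y : ℝ, AEStronglyMeasurable (fun a => Real.exp (-(y * u a))) μ := fun y =>
    ((hu.const_mul y).neg.exp).aestronglyMeasurable
  refine hasDerivAt_integral_of_dominated_loc_of_deriv_le
    (F := fun y a => Real.exp (-(y * u a)) * g a)
    (F' := fun y a => Real.exp (-(y * u a)) * (-u a * g a))
    (bound := fun a => 4 / x * ‖Real.exp (-(x / 4 * u a)) * g a‖)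
    (Ioi_mem_nhds (half_lt_self hx)) (Eventually.of_forall fun y => (hm y).mul hgm) (hg x hx)
    ((hm x).mul (hu.neg.aestronglyMeasurable.mul hgm)) (ae_of_all _ fun a y hy => ?_)
    ((hg (x / 4) (by positivity)).norm.const_mul _) (ae_of_all _ fun a y _ => ?_)
  · have hy : x / 2 < y := hy
    have h1 : u a ≤ 4 / x * Real.exp (x / 4 * u a) := by
      rw [div_mul_eq_mul_div, le_div_iff₀ hx]
      linarith [Real.add_one_le_exp (x / 4 * u a)]
    have h2 : Real.exp (-(y * u a)) ≤ Real.exp (-(x / 2 * u a)) :=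
      Real.exp_le_exp.2 (neg_le_neg (mul_le_mul_of_nonneg_right hy.le (hu0 a)))
    have h3 : Real.exp (x / 4 * u a) * Real.exp (-(x / 2 * u a)) = Real.exp (-(x / 4 * u a)) := by
      rw [← Real.exp_add]; ring_nf
    simp only [norm_mul, norm_neg, Real.norm_eq_abs, Real.abs_exp, abs_of_nonneg (hu0 a)]
    calc Real.exp (-(y * u a)) * (u a * |g a|)
        ≤ Real.exp (-(x / 2 * u a)) * (4 / x * Real.exp (x / 4 * u a) * |g a|) := by
          have := hu0 a
          gcongr
      _ = 4 / x * (Real.exp (-(x / 4 * u a)) * |g a|) := by rw [← h3]; ring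
  · have h := (((hasDerivAt_id y).mul_const (u a)).neg.exp).mul_const (g a)
    refine h.congr_deriv ?_
    simp [mul_assoc]

theorem laplaceIntegral_contDiffOn (hu : Measurable u) (hu0 : ∀ a, 0 ≤ u a)
    (hg : ∀ x > 0, Integrable (fun a => Real.exp (-(x * u a)) * g a) μ) :
    ContDiffOn ℝ (⊤ : ℕ∞) (laplaceIntegral μ u g) (Ioi 0) := by
  refine contDiffOn_infty.2 fun n => ?_
  induction n generalizing g with
  | zero =>
    exact contDiffOn_zero.2 fun x hx =>
      (laplaceIntegral_hasDerivAt hu hu0 hg hx).2.continuousAt.continuousWithinAt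
  | succ n ih =>
    push_cast
    refine (contDiffOn_succ_iff_deriv_of_isOpen isOpen_Ioi).2
      ⟨fun x hx =>
        (laplaceIntegral_hasDerivAt hu hu0 hg hx).2.differentiableAt.differentiableWithinAt,
        by simp, ?_⟩
    exact (ih fun x hx => (laplaceIntegral_hasDerivAt hu hu0 hg hx).1).congr fun x hx =>
      (laplaceIntegral_hasDerivAt hu hu0 hg hx).2.deriv

theorem laplaceIntegral_iteratedDeriv (hu : Measurable u) (hu0 : ∀ a, 0 ≤ u a) (n : ℕ)
    (hg : ∀ x > 0, Integrable (fun a => Real.exp (-(x * u a)) * g a) μ) {x : ℝ} (hx : 0 < x) :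
    iteratedDeriv n (laplaceIntegral μ u g) x =
      laplaceIntegral μ u (fun a => (-u a) ^ n * g a) x := by
  induction n generalizing g with
  | zero => simp
  | succ n ih =>
    have h : deriv (laplaceIntegral μ u g) =ᶠ[𝓝 x] laplaceIntegral μ u (fun a => -u a * g a) := by
      filter_upwards [Ioi_mem_nhds hx] with y hy
      exact (laplaceIntegral_hasDerivAt hu hu0 hg hy).2.deriv
    rw [iteratedDeriv_succ', h.iteratedDeriv_eq,
      ih fun y hy => (laplaceIntegral_hasDerivAt hu hu0 hg hy).1]
    simp only [pow_succ, mul_assoc]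

theorem laplaceIntegral_completelyMonotonicOn (hu : Measurable u) (hu0 : ∀ a, 0 ≤ u a)
    (hg : ∀ x > 0, Integrable (fun a => Real.exp (-(x * u a)) * g a) μ)
    (hg0 : ∀ᵐ a ∂μ, 0 ≤ g a) : CompletelyMonotonicOn (laplaceIntegral μ u g) := by
  refine ⟨laplaceIntegral_contDiffOn hu hu0 hg, fun n x hx => ?_⟩
  rw [laplaceIntegral_iteratedDeriv hu hu0 n hg hx, laplaceIntegral, ← integral_const_mul]
  refine integral_nonneg_of_ae ?_
  filter_upwards [hg0] with a ha
  have h : (-1 : ℝ) ^ n * (Real.exp (-(x * u a)) * ((-u a) ^ n * g a)) =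
      Real.exp (-(x * u a)) * (u a ^ n * g a) := by
    have h1 : (-1 : ℝ) ^ n * (-1) ^ n = 1 := by rw [← mul_pow]; simp
    rw [neg_pow (u a)]
    linear_combination (Real.exp (-(x * u a)) * (u a ^ n * g a)) * h1
  have := hu0 a
  simp only [h, Pi.zero_apply]
  positivity

end LaplaceIntegral

theorem CompletelyMonotonicOn.congr {F G : ℝ → ℝ} (hF : CompletelyMonotonicOn F)
    (h : ∀ x, 0 < x → G x = F x) : CompletelyMonotonicOn G := by
  refine ⟨hF.1.congr fun x hx => h x hx, fun n x hx => ?_⟩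
  have : G =ᶠ[𝓝 x] F := by
    filter_upwards [Ioi_mem_nhds hx] with y hy using h y hy
  rw [this.iteratedDeriv_eq]
  exact hF.2 n x hx

theorem CompletelyMonotonicOn.nonneg {F : ℝ → ℝ} (hF : CompletelyMonotonicOn F) {x : ℝ}
    (hx : 0 < x) : 0 ≤ F x := by
  simpa using hF.2 0 x hx

theorem Real.half_sq_le_cosh_sub_one {t : ℝ} (ht : 0 ≤ t) : t ^ 2 / 2 ≤ Real.cosh t - 1 := by
  have h1 : t / 2 ≤ Real.sinh (t / 2) := Real.self_le_sinh_iff.2 (by positivity)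
  have h2 : Real.cosh t = Real.cosh (t / 2) ^ 2 + Real.sinh (t / 2) ^ 2 := by
    rw [← Real.cosh_two_mul]; ring_nf
  nlinarith [Real.cosh_sq (t / 2)]

theorem Real.cosh_le_exp_abs (t : ℝ) : Real.cosh t ≤ Real.exp |t| := by
  rw [← Real.cosh_abs, Real.cosh_eq]
  have := Real.exp_le_exp.2 (show -|t| ≤ |t| by linarith [abs_nonneg t])
  linarith

theorem exp_neg_mul_cosh_sub_one_mul_cosh_le (v : ℝ) {x t : ℝ} (hx : 0 < x) (ht : 0 ≤ t) :
    Real.exp (-(x * (Real.cosh t - 1))) * Real.cosh (v * t) ≤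
      Real.exp ((|v| + 1) ^ 2 / (2 * x)) * Real.exp (-t) := by
  have h1 := mul_le_mul_of_nonneg_left (Real.half_sq_le_cosh_sub_one ht) hx.le
  have h2 : (|v| + 1) ^ 2 / (2 * x) - (|v| + 1) * t + x * (t ^ 2 / 2) =
      ((|v| + 1) - x * t) ^ 2 / (2 * x) := by
    field_simp; ring
  have h3 : 0 ≤ ((|v| + 1) - x * t) ^ 2 / (2 * x) := by positivity
  calc _ ≤ Real.exp (-(x * (Real.cosh t - 1))) * Real.exp (|v| * t) := by
        gcongr
        simpa [abs_mul, abs_of_nonneg ht] using Real.cosh_le_exp_abs (v * t)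
    _ ≤ _ := by
        rw [← Real.exp_add, ← Real.exp_add, Real.exp_le_exp]
        linarith

theorem integrable_exp_neg_mul_cosh_sub_one {g : ℝ → ℝ} (hg : Continuous g) {v C : ℝ}
    (hC : ∀ t, |g t| ≤ C * Real.cosh (v * t)) {x : ℝ} (hx : 0 < x) :
    Integrable (fun t => Real.exp (-(x * (Real.cosh t - 1))) * g t)
      (volume.restrict (Ioi 0)) := by
  have hC0 : 0 ≤ C := by simpa using (abs_nonneg _).trans (hC 0)
  have hcont : Continuous fun t => Real.exp (-(x * (Real.cosh t - 1))) * g t := by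
    have := Real.continuous_cosh
    fun_prop
  refine Integrable.mono' ((integrableOn_exp_neg_Ioi 0).const_mul
    (C * Real.exp ((|v| + 1) ^ 2 / (2 * x)))) hcont.aestronglyMeasurable ?_
  filter_upwards [ae_restrict_mem measurableSet_Ioi] with t ht
  rw [norm_mul, Real.norm_eq_abs, Real.norm_eq_abs, Real.abs_exp, mul_assoc C]
  calc _ ≤ Real.exp (-(x * (Real.cosh t - 1))) * (C * Real.cosh (v * t)) := by
        gcongr; exact hC t
    _ = C * (Real.exp (-(x * (Real.cosh t - 1))) * Real.cosh (v * t)) := by ring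
    _ ≤ _ := mul_le_mul_of_nonneg_left
          (exp_neg_mul_cosh_sub_one_mul_cosh_le v hx (le_of_lt ht)) hC0

theorem Real.hasDerivAt_tanh (t : ℝ) : HasDerivAt Real.tanh (1 - Real.tanh t ^ 2) t := by
  have hc := (Real.cosh_pos t).ne'
  have h := (Real.hasDerivAt_sinh t).div (Real.hasDerivAt_cosh t) hc
  have he : Real.tanh = Real.sinh / Real.cosh := funext Real.tanh_eq_sinh_div_cosh
  rw [he]
  refine h.congr_deriv ?_
  rw [Pi.div_apply]
  field_simp

theorem Real.continuous_tanh : Continuous Real.tanh :=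
  continuous_iff_continuousAt.2 fun t => (Real.hasDerivAt_tanh t).continuousAt

theorem Real.tanh_monotone : Monotone Real.tanh :=
  monotone_of_deriv_nonneg (fun t => (Real.hasDerivAt_tanh t).differentiableAt) fun t => by
    rw [(Real.hasDerivAt_tanh t).deriv]
    linarith [Real.tanh_sq_lt_one t]

theorem Real.tanh_nonneg {t : ℝ} (ht : 0 ≤ t) : 0 ≤ Real.tanh t := by
  simpa using Real.tanh_monotone ht

theorem Real.tendsto_tanh_atTop : Tendsto Real.tanh atTop (𝓝 1) := by
  have h : Tendsto (fun t : ℝ => 1 - Real.exp (-t)) atTop (𝓝 1) := by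
    simpa using (Real.tendsto_exp_neg_atTop_nhds_zero).const_sub 1
  refine tendsto_of_tendsto_of_tendsto_of_le_of_le h tendsto_const_nhds (fun t => ?_)
    fun t => (Real.tanh_lt_one t).le
  have hc := Real.one_le_cosh t
  have : 1 - Real.tanh t = Real.exp (-t) / Real.cosh t := by
    rw [Real.tanh_eq_sinh_div_cosh, ← Real.cosh_sub_sinh]
    field_simp
  have := div_le_self (Real.exp_pos (-t)).le hc
  simp only
  linarith

/-- The ratio of the derivative of `tanh (t / 2) * cosh (v * t)` to `cosh (v * t)`. -/
noncomputable def besselRatio (v t : ℝ) : ℝ :=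
  (1 - Real.tanh (t / 2) ^ 2) / 2 + v * Real.tanh (t / 2) * Real.tanh (v * t)

theorem continuous_besselRatio (v : ℝ) : Continuous (besselRatio v) := by
  have := Real.continuous_tanh
  unfold besselRatio
  fun_prop

theorem besselRatio_zero (v : ℝ) : besselRatio v 0 = 1 / 2 := by
  simp [besselRatio]

theorem abs_besselRatio_le (v t : ℝ) : |besselRatio v t| ≤ 1 / 2 + |v| := by
  have h1 := Real.tanh_sq_lt_one (t / 2)
  have h2 : |v * Real.tanh (t / 2) * Real.tanh (v * t)| ≤ |v| := by
    rw [abs_mul, abs_mul, mul_assoc]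
    exact mul_le_of_le_one_right (abs_nonneg v)
      (mul_le_one₀ (Real.abs_tanh_lt_one _).le (abs_nonneg _) (Real.abs_tanh_lt_one _).le)
  refine (abs_add_le _ _).trans (add_le_add ?_ h2)
  rw [abs_le]
  constructor <;> nlinarith [sq_nonneg (Real.tanh (t / 2))]

theorem tendsto_besselRatio_atTop {v : ℝ} (hv : 0 < v) :
    Tendsto (besselRatio v) atTop (𝓝 v) := by
  have h1 : Tendsto (fun t : ℝ => Real.tanh (t / 2)) atTop (𝓝 1) :=
    Real.tendsto_tanh_atTop.comp (tendsto_id.atTop_div_const two_pos)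
  have h2 : Tendsto (fun t : ℝ => Real.tanh (v * t)) atTop (𝓝 1) :=
    Real.tendsto_tanh_atTop.comp (tendsto_id.const_mul_atTop hv)
  have h := (((h1.pow 2).const_sub 1).div_const 2).add ((h1.const_mul v).mul h2)
  have he : besselRatio v = fun t =>
      (1 - Real.tanh (t / 2) ^ 2) / 2 + v * Real.tanh (t / 2) * Real.tanh (v * t) := rfl
  simpa [he] using h

theorem besselRatio_le_of_one_le {v t : ℝ} (hv : 1 ≤ v) (ht : 0 ≤ t) : besselRatio v t ≤ v := by
  have h0 : 0 ≤ Real.tanh (t / 2) := Real.tanh_nonneg (by positivity)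
  have h1 := Real.tanh_lt_one (t / 2)
  have h2 : v * Real.tanh (t / 2) * Real.tanh (v * t) ≤ v * Real.tanh (t / 2) :=
    mul_le_of_le_one_right (by positivity) (Real.tanh_lt_one _).le
  unfold besselRatio
  nlinarith [mul_nonneg (sub_nonneg.2 h1.le) (sub_nonneg.2 hv)]

theorem besselRatio_le_half {v t : ℝ} (hv0 : 0 < v) (hv : v < 1 / 2) (ht : 0 ≤ t) :
    besselRatio v t ≤ 1 / 2 := by
  have h0 : 0 ≤ Real.tanh (t / 2) := Real.tanh_nonneg (by positivity)
  have h1 : Real.tanh (v * t) ≤ Real.tanh (t / 2) := Real.tanh_monotone (by nlinarith)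
  have h2 : v * Real.tanh (v * t) ≤ 1 / 2 * Real.tanh (t / 2) :=
    (mul_le_mul_of_nonneg_left h1 hv0.le).trans (mul_le_mul_of_nonneg_right hv.le h0)
  unfold besselRatio
  nlinarith [mul_le_mul_of_nonneg_left h2 h0]

theorem half_le_besselRatio {v t : ℝ} (hv : 1 / 2 < v) (ht : 0 ≤ t) :
    1 / 2 ≤ besselRatio v t := by
  have h0 : 0 ≤ Real.tanh (t / 2) := Real.tanh_nonneg (by positivity)
  have h1 : Real.tanh (t / 2) ≤ Real.tanh (v * t) := Real.tanh_monotone (by nlinarith)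
  have h2 : 1 / 2 * Real.tanh (t / 2) ≤ v * Real.tanh (v * t) := by gcongr
  unfold besselRatio
  nlinarith [mul_le_mul_of_nonneg_left h2 h0]

theorem integrable_cosh (v : ℝ) {x : ℝ} (hx : 0 < x) :
    Integrable (fun t => Real.exp (-(x * (Real.cosh t - 1))) * Real.cosh (v * t))
      (volume.restrict (Ioi 0)) :=
  integrable_exp_neg_mul_cosh_sub_one (g := fun t => Real.cosh (v * t)) (v := v) (C := 1)
    (Real.continuous_cosh.comp (by fun_prop)) (fun t => by
      rw [abs_of_pos (Real.cosh_pos _), one_mul]) hx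

theorem integrable_cosh_mul_besselRatio (v : ℝ) {x : ℝ} (hx : 0 < x) :
    Integrable (fun t => Real.exp (-(x * (Real.cosh t - 1))) *
      (Real.cosh (v * t) * besselRatio v t)) (volume.restrict (Ioi 0)) :=
  integrable_exp_neg_mul_cosh_sub_one (g := fun t => Real.cosh (v * t) * besselRatio v t)
    (v := v) (C := 1 / 2 + |v|)
    ((Real.continuous_cosh.comp (by fun_prop)).mul (continuous_besselRatio v)) (fun t => by
      rw [abs_mul, abs_of_pos (Real.cosh_pos _), mul_comm]
      exact mul_le_mul_of_nonneg_right (abs_besselRatio_le v t) (Real.cosh_pos _).le) hx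

theorem laplaceIntegral_cosh_besselRatio (v : ℝ) {x : ℝ} (hx : 0 < x) :
    laplaceIntegral (volume.restrict (Ioi 0)) (fun t => Real.cosh t - 1)
        (fun t => Real.cosh (v * t) * besselRatio v t) x =
      -(x * laplaceIntegral (volume.restrict (Ioi 0)) (fun t => Real.cosh t - 1)
        (fun t => -(Real.cosh t - 1) * Real.cosh (v * t)) x) := by
  have hint1 := integrable_cosh_mul_besselRatio v hx
  have hint2 := (laplaceIntegral_hasDerivAt (u := fun t => Real.cosh t - 1)
    (Real.measurable_cosh.sub_const 1) (fun t => sub_nonneg.2 (Real.one_le_cosh t))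
    (fun y hy => integrable_cosh v hy) hx).1.const_mul x
  have hderiv : ∀ t ∈ Ici (0 : ℝ), HasDerivAt
      (fun t => Real.tanh (t / 2) * (Real.exp (-(x * (Real.cosh t - 1))) * Real.cosh (v * t)))
      (Real.exp (-(x * (Real.cosh t - 1))) * (Real.cosh (v * t) * besselRatio v t) +
        x * (Real.exp (-(x * (Real.cosh t - 1))) * (-(Real.cosh t - 1) * Real.cosh (v * t)))) t := by
    intro t _
    have h1 := (Real.hasDerivAt_tanh (t / 2)).comp t ((hasDerivAt_id t).div_const 2)
    have h2 := (((Real.hasDerivAt_cosh t).sub_const 1).const_mul x).neg.exp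
    have h3 := ((hasDerivAt_id t).const_mul v).cosh
    refine (h1.mul (h2.mul h3)).congr_deriv ?_
    have hc := (Real.cosh_pos (t / 2)).ne'
    have hcv := (Real.cosh_pos (v * t)).ne'
    have ht : t = 2 * (t / 2) := by ring
    have e1 : Real.tanh (t / 2) * Real.sinh t = Real.cosh t - 1 := by
      have e2 : Real.sinh t = 2 * Real.sinh (t / 2) * Real.cosh (t / 2) := by
        rw [← Real.sinh_two_mul, ← ht]
      have e3 : Real.cosh t = Real.cosh (t / 2) ^ 2 + Real.sinh (t / 2) ^ 2 := by
        rw [← Real.cosh_two_mul, ← ht]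
      rw [Real.tanh_eq_sinh_div_cosh, e2, e3, Real.cosh_sq]
      field_simp
      ring
    have e4 : Real.cosh (v * t) * Real.tanh (v * t) = Real.sinh (v * t) := by
      rw [Real.tanh_eq_sinh_div_cosh]; field_simp
    simp only [Function.comp_apply, Pi.mul_apply, id, besselRatio]
    rw [← e4]
    linear_combination (-x * Real.exp (-(x * (Real.cosh t - 1))) * Real.cosh (v * t)) * e1
  have hlim : Tendsto
      (fun t => Real.tanh (t / 2) * (Real.exp (-(x * (Real.cosh t - 1))) * Real.cosh (v * t)))
      atTop (𝓝 0) := by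
    have hb : Tendsto (fun t : ℝ => Real.exp ((|v| + 1) ^ 2 / (2 * x)) * Real.exp (-t))
        atTop (𝓝 0) := by
      simpa using Real.tendsto_exp_neg_atTop_nhds_zero.const_mul
        (Real.exp ((|v| + 1) ^ 2 / (2 * x)))
    refine squeeze_zero' ?_ ?_ hb
    · filter_upwards [eventually_ge_atTop 0] with t ht
      have := Real.tanh_nonneg (show 0 ≤ t / 2 by positivity)
      have := Real.cosh_pos (v * t)
      positivity
    · filter_upwards [eventually_ge_atTop 0] with t ht
      have hc := Real.cosh_pos (v * t)
      exact (mul_le_of_le_one_left (by positivity) (Real.tanh_lt_one _).le).trans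
        (exp_neg_mul_cosh_sub_one_mul_cosh_le v hx ht)
  have h := integral_Ioi_of_hasDerivAt_of_tendsto' hderiv (hint1.add hint2) hlim
  rw [integral_add hint1 hint2, integral_const_mul] at h
  simp only [zero_div, Real.tanh_zero, zero_mul, sub_zero] at h
  exact eq_neg_of_add_eq_zero_left h

theorem besselCombination_eq_laplaceIntegral {v lam : ℝ} {K P : ℝ → ℝ}
    (hK : ∀ x, K x = ∫ t in Ioi (0 : ℝ), Real.exp (-x * Real.cosh t) * Real.cosh (v * t))
    (hP : ∀ x, P x = (x + lam) * Real.exp x * K x + x * Real.exp x * deriv K x)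
    {x : ℝ} (hx : 0 < x) :
    P x = laplaceIntegral (volume.restrict (Ioi 0)) (fun t => Real.cosh t - 1)
      (fun t => Real.cosh (v * t) * (lam - besselRatio v t)) x := by
  have hint1 := integrable_cosh_mul_besselRatio v hx
  have hK' : K = (fun y => Real.exp (-y)) * laplaceIntegral (volume.restrict (Ioi 0))
      (fun t => Real.cosh t - 1) (fun t => Real.cosh (v * t)) := by
    funext y
    rw [hK, Pi.mul_apply, laplaceIntegral, ← integral_const_mul]
    congr 1 with t
    rw [← mul_assoc, ← Real.exp_add]
    ring_nf
  have hd := (laplaceIntegral_hasDerivAt (u := fun t => Real.cosh t - 1)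
    (Real.measurable_cosh.sub_const 1) (fun t => sub_nonneg.2 (Real.one_le_cosh t))
    (fun y hy => integrable_cosh v hy) hx).2
  have hKd := (hasDerivAt_neg x).exp.mul hd
  have hsplit : laplaceIntegral (volume.restrict (Ioi 0)) (fun t => Real.cosh t - 1)
      (fun t => Real.cosh (v * t) * (lam - besselRatio v t)) x =
      lam * laplaceIntegral (volume.restrict (Ioi 0)) (fun t => Real.cosh t - 1)
        (fun t => Real.cosh (v * t)) x -
      laplaceIntegral (volume.restrict (Ioi 0)) (fun t => Real.cosh t - 1)
        (fun t => Real.cosh (v * t) * besselRatio v t) x := by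
    simp only [laplaceIntegral]
    rw [← integral_const_mul, ← integral_sub ((integrable_cosh v hx).const_mul lam) hint1]
    congr 1 with t
    ring
  have hexp : Real.exp x * Real.exp (-x) = 1 := by rw [← Real.exp_add]; simp
  rw [← hK'] at hKd
  rw [hsplit, laplaceIntegral_cosh_besselRatio v hx, hP, hKd.deriv, congrFun hK' x, Pi.mul_apply]
  set L := laplaceIntegral (volume.restrict (Ioi 0)) (fun t => Real.cosh t - 1)
    (fun t => Real.cosh (v * t)) x
  set L' := laplaceIntegral (volume.restrict (Ioi 0)) (fun t => Real.cosh t - 1)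
    (fun t => -(Real.cosh t - 1) * Real.cosh (v * t)) x
  linear_combination (lam * L + x * L') * hexp

/-- If the density is negative near infinity, its Laplace-type integral is negative somewhere
near `0`. -/
theorem exists_laplaceIntegral_neg_of_eventually_le {g : ℝ → ℝ} (hg : Continuous g) {ε : ℝ}
    (hε : 0 < ε) (hev : ∀ᶠ t in atTop, g t ≤ -ε)
    (hint : ∀ x > 0, Integrable (fun t => Real.exp (-(x * (Real.cosh t - 1))) * g t)
      (volume.restrict (Ioi 0))) :
    ∃ x > 0, laplaceIntegral (volume.restrict (Ioi 0)) (fun t => Real.cosh t - 1) g x < 0 := by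
  obtain ⟨T, hT⟩ := eventually_atTop.1 hev
  obtain ⟨B, hB⟩ := (isCompact_Icc (a := (0 : ℝ)) (b := max T 0)).exists_bound_of_continuousOn
    hg.continuousOn
  have hB0 : 0 ≤ B := (norm_nonneg _).trans (hB 0 (by simp))
  obtain ⟨N, hN1, hN2, hN3⟩ : ∃ N : ℝ, max T 0 ≤ N ∧ 1 ≤ N ∧
      (B + ε) * max T 0 < ε * Real.exp (-1) * N := by
    have h : Tendsto (fun N : ℝ => ε * Real.exp (-1) * N) atTop atTop :=
      tendsto_id.const_mul_atTop (by positivity)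
    obtain ⟨N, h⟩ := ((eventually_ge_atTop (max T 0)).and
      ((eventually_ge_atTop 1).and (h.eventually_gt_atTop ((B + ε) * max T 0)))).exists
    exact ⟨N, h⟩
  have hN0 : 0 < N := one_pos.trans_le hN2
  have hu : 0 < Real.cosh N - 1 := sub_pos.2 (Real.one_lt_cosh.2 hN0.ne')
  refine ⟨(Real.cosh N - 1)⁻¹, inv_pos.2 hu, ?_⟩
  set x := (Real.cosh N - 1)⁻¹ with hx
  have hx0 : 0 < x := inv_pos.2 hu
  have hpt : ∀ t ∈ Ioi (0 : ℝ), Real.exp (-(x * (Real.cosh t - 1))) * g t ≤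
      (Ioc 0 (max T 0)).indicator (fun _ => B + ε) t -
        (Ioc 0 N).indicator (fun _ => ε * Real.exp (-1)) t := by
    intro t ht
    have ht : 0 < t := ht
    have hle : Real.exp (-(x * (Real.cosh t - 1))) ≤ 1 := by
      rw [Real.exp_le_one_iff]
      have := mul_nonneg hx0.le (sub_nonneg.2 (Real.one_le_cosh t))
      linarith
    have hge : t ≤ N → Real.exp (-1) ≤ Real.exp (-(x * (Real.cosh t - 1))) := by
      intro htN
      have hc : Real.cosh t ≤ Real.cosh N := by
        rw [Real.cosh_le_cosh, abs_of_pos ht, abs_of_pos hN0]; exact htN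
      rw [Real.exp_le_exp, neg_le_neg_iff]
      calc x * (Real.cosh t - 1) ≤ x * (Real.cosh N - 1) :=
            mul_le_mul_of_nonneg_left (by linarith) hx0.le
        _ = 1 := inv_mul_cancel₀ hu.ne'
    have hpos := Real.exp_pos (-(x * (Real.cosh t - 1)))
    by_cases h1 : t ≤ max T 0
    · have hgt := (le_abs_self _).trans (hB t ⟨ht.le, h1⟩)
      rw [indicator_of_mem (mem_Ioc.2 ⟨ht, h1⟩),
        indicator_of_mem (mem_Ioc.2 ⟨ht, h1.trans hN1⟩)]
      have := hge (h1.trans hN1)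
      nlinarith
    · have hgt := hT t ((le_max_left _ _).trans (not_le.1 h1).le)
      rw [indicator_of_notMem (fun h => h1 h.2)]
      by_cases h2 : t ≤ N
      · rw [indicator_of_mem (mem_Ioc.2 ⟨ht, h2⟩)]
        have := hge h2
        nlinarith
      · rw [indicator_of_notMem (fun h => h2 h.2)]
        nlinarith
  have hi : ∀ a c : ℝ, 0 ≤ a → Integrable ((Ioc 0 a).indicator (fun _ => c))
      (volume.restrict (Ioi 0)) ∧
      ∫ t in Ioi (0 : ℝ), (Ioc 0 a).indicator (fun _ => c) t = a * c := by
    intro a c ha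
    constructor
    · exact ((integrable_indicator_iff measurableSet_Ioc).2
        (integrableOn_const measure_Ioc_lt_top.ne)).restrict
    · rw [setIntegral_indicator measurableSet_Ioc,
        inter_eq_right.2 Ioc_subset_Ioi_self, setIntegral_const]
      simp [ha]
  have hT0 := hi (max T 0) (B + ε) (le_max_right _ _)
  have hN0' := hi N (ε * Real.exp (-1)) hN0.le
  have h := setIntegral_mono_on (hint x hx0) (hT0.1.sub hN0'.1) measurableSet_Ioi hpt
  refine h.trans_lt ?_
  have := integral_sub hT0.1 hN0'.1
  rw [hT0.2, hN0'.2] at this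
  refine this.trans_lt ?_
  linarith

/-- If the density is negative at `0`, its Laplace-type integral is negative somewhere
near infinity. -/
theorem exists_laplaceIntegral_neg_of_neg {g : ℝ → ℝ} (hg : Continuous g) (h0 : g 0 < 0)
    (hint : ∀ x > 0, Integrable (fun t => Real.exp (-(x * (Real.cosh t - 1))) * g t)
      (volume.restrict (Ioi 0))) :
    ∃ x > 0, laplaceIntegral (volume.restrict (Ioi 0)) (fun t => Real.cosh t - 1) g x < 0 := by
  obtain ⟨ε, hε, hgε⟩ : ∃ ε > 0, g 0 < -ε := ⟨-g 0 / 2, by linarith, by linarith⟩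
  obtain ⟨r, hr, hball⟩ := Metric.eventually_nhds_iff.1
    (hg.continuousAt.eventually (gt_mem_nhds hgε))
  obtain ⟨d, hd, hdr⟩ : ∃ d > 0, 2 * d < r := ⟨r / 4, by positivity, by linarith⟩
  set A := ∫ t in Ioi (0 : ℝ), ‖Real.exp (-(1 * (Real.cosh t - 1))) * g t‖ with hA
  set U := Real.cosh (2 * d) - 1 with hU
  set V := Real.cosh d - 1 with hV
  have hUV : 0 < U - V := by
    have : Real.cosh d < Real.cosh (2 * d) := by
      rw [Real.cosh_lt_cosh, abs_of_pos hd, abs_of_pos (by positivity)]; linarith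
    linarith
  obtain ⟨x, hx1, hx2⟩ : ∃ x : ℝ, 1 ≤ x ∧
      A * Real.exp U * Real.exp (-(x * (U - V))) < ε * d := by
    have h : Tendsto (fun x : ℝ => A * Real.exp U * Real.exp (-(x * (U - V)))) atTop (𝓝 0) := by
      simpa using (Real.tendsto_exp_neg_atTop_nhds_zero.comp
        (tendsto_id.atTop_mul_const hUV)).const_mul (A * Real.exp U)
    obtain ⟨x, hx⟩ := ((eventually_ge_atTop 1).and
      (h.eventually (gt_mem_nhds (show 0 < ε * d by positivity)))).exists
    exact ⟨x, hx⟩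
  have hx0 : 0 < x := one_pos.trans_le hx1
  refine ⟨x, hx0, ?_⟩
  have hpt : ∀ t ∈ Ioi (0 : ℝ), Real.exp (-(x * (Real.cosh t - 1))) * g t ≤
      Real.exp (-((x - 1) * U)) * ‖Real.exp (-(1 * (Real.cosh t - 1))) * g t‖ -
        (Ioc 0 d).indicator (fun _ => ε * Real.exp (-(x * V))) t := by
    intro t ht
    have ht : 0 < t := ht
    have hpos := Real.exp_pos (-(x * (Real.cosh t - 1)))
    have hnn : 0 ≤ Real.exp (-((x - 1) * U)) *
      ‖Real.exp (-(1 * (Real.cosh t - 1))) * g t‖ := by positivity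
    have hneg : t ≤ 2 * d → g t < -ε := fun h => hball (by
      rw [Real.dist_eq, sub_zero, abs_of_pos ht]; linarith)
    by_cases h1 : t ≤ d
    · rw [indicator_of_mem (mem_Ioc.2 ⟨ht, h1⟩)]
      have hgt := hneg (by linarith)
      have hc : Real.cosh t ≤ Real.cosh d := by
        rw [Real.cosh_le_cosh, abs_of_pos ht, abs_of_pos hd]; exact h1
      have : Real.exp (-(x * V)) ≤ Real.exp (-(x * (Real.cosh t - 1))) := by
        rw [Real.exp_le_exp, neg_le_neg_iff]
        exact mul_le_mul_of_nonneg_left (by linarith) hx0.le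
      nlinarith
    · rw [indicator_of_notMem (fun h => h1 h.2), sub_zero]
      by_cases h2 : t ≤ 2 * d
      · have hgt := hneg h2
        nlinarith
      · have hc : Real.cosh (2 * d) ≤ Real.cosh t := by
          rw [Real.cosh_le_cosh, abs_of_pos ht, abs_of_pos (by positivity)]; linarith
        rw [norm_mul, Real.norm_eq_abs, Real.norm_eq_abs, Real.abs_exp, ← mul_assoc,
          ← Real.exp_add]
        refine (mul_le_mul_of_nonneg_left (le_abs_self _) hpos.le).trans
          (mul_le_mul_of_nonneg_right ?_ (abs_nonneg _))
        rw [Real.exp_le_exp]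
        nlinarith [mul_nonneg (sub_nonneg.2 hx1) (sub_nonneg.2 hc)]
  have hi : Integrable ((Ioc 0 d).indicator (fun _ => ε * Real.exp (-(x * V))))
      (volume.restrict (Ioi 0)) := ((integrable_indicator_iff measurableSet_Ioc).2
        (integrableOn_const measure_Ioc_lt_top.ne)).restrict
  have hA' := (hint 1 one_pos).norm.const_mul (Real.exp (-((x - 1) * U)))
  have h := setIntegral_mono_on (hint x hx0) (hA'.sub hi) measurableSet_Ioi hpt
  refine h.trans_lt ((integral_sub hA' hi).trans_lt ?_)
  rw [integral_const_mul, ← hA, setIntegral_indicator measurableSet_Ioc,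
    inter_eq_right.2 Ioc_subset_Ioi_self, setIntegral_const]
  have hexp : Real.exp (-((x - 1) * U)) =
      Real.exp U * Real.exp (-(x * (U - V))) * Real.exp (-(x * V)) := by
    rw [← Real.exp_add, ← Real.exp_add]; ring_nf
  have := mul_lt_mul_of_pos_right hx2 (Real.exp_pos (-(x * V)))
  simp only [measureReal_def, Real.volume_Ioc, sub_zero, ENNReal.toReal_ofReal hd.le, smul_eq_mul]
  rw [hexp]
  linarith

theorem continuous_cosh_mul_sub_besselRatio (v lam : ℝ) :
    Continuous fun t => Real.cosh (v * t) * (lam - besselRatio v t) :=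
  (Real.continuous_cosh.comp (by fun_prop)).mul
    (continuous_const.sub (continuous_besselRatio v))

theorem integrable_cosh_mul_sub_besselRatio (v lam : ℝ) {x : ℝ} (hx : 0 < x) :
    Integrable (fun t => Real.exp (-(x * (Real.cosh t - 1))) *
      (Real.cosh (v * t) * (lam - besselRatio v t))) (volume.restrict (Ioi 0)) := by
  refine (((integrable_cosh v hx).const_mul lam).sub
    (integrable_cosh_mul_besselRatio v hx)).congr (ae_of_all _ fun t => ?_)
  simp only [Pi.sub_apply]
  ring

theorem stmt_18 (v lam : ℝ)
    (K : ℝ → ℝ)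
    (hK : ∀ x, K x = ∫ t in Ioi (0 : ℝ), Real.exp (-x * Real.cosh t) * Real.cosh (v * t))
    (P : ℝ → ℝ)
    (hP : ∀ x, P x = (x + lam) * Real.exp x * K x + x * Real.exp x * deriv K x) :
    (1 ≤ v → (CompletelyMonotonicOn P ↔ v ≤ lam)) ∧
    (0 < v → v < 1 / 2 → (CompletelyMonotonicOn P ↔ 1 / 2 ≤ lam)) ∧
    (1 / 2 < v → (CompletelyMonotonicOn (fun x => -P x) ↔ lam ≤ 1 / 2)) := by
  have hrepr : ∀ x, 0 < x → P x = laplaceIntegral (volume.restrict (Ioi 0))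
      (fun t => Real.cosh t - 1) (fun t => Real.cosh (v * t) * (lam - besselRatio v t)) x :=
    fun x hx => besselCombination_eq_laplaceIntegral hK hP hx
  have hnrepr : ∀ x, 0 < x → -P x = laplaceIntegral (volume.restrict (Ioi 0))
      (fun t => Real.cosh t - 1) (fun t => -(Real.cosh (v * t) * (lam - besselRatio v t))) x := by
    intro x hx
    rw [hrepr x hx]
    simp only [laplaceIntegral, mul_neg, integral_neg]
  have hint := fun x (hx : 0 < x) => integrable_cosh_mul_sub_besselRatio v lam hx
  have hnint : ∀ x > 0, Integrable (fun t => Real.exp (-(x * (Real.cosh t - 1))) *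
      -(Real.cosh (v * t) * (lam - besselRatio v t))) (volume.restrict (Ioi 0)) :=
    fun x hx => (hint x hx).neg.congr (ae_of_all _ fun t => (mul_neg _ _).symm)
  have hcont := continuous_cosh_mul_sub_besselRatio v lam
  have hmeas : Measurable fun t => Real.cosh t - 1 := Real.measurable_cosh.sub_const 1
  have hnonneg : ∀ t, 0 ≤ Real.cosh t - 1 := fun t => sub_nonneg.2 (Real.one_le_cosh t)
  have hpos : (∀ t, 0 ≤ t → besselRatio v t ≤ lam) → CompletelyMonotonicOn P := fun h =>
    (laplaceIntegral_completelyMonotonicOn hmeas hnonneg hint (by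
      filter_upwards [ae_restrict_mem measurableSet_Ioi] with t ht
      exact mul_nonneg (Real.cosh_pos _).le (sub_nonneg.2 (h t (le_of_lt ht))))).congr hrepr
  refine ⟨fun hv => ⟨fun hcm => ?_, fun h => hpos fun t ht =>
      (besselRatio_le_of_one_le hv ht).trans h⟩,
    fun hv0 hv => ⟨fun hcm => ?_, fun h => hpos fun t ht =>
      (besselRatio_le_half hv0 hv ht).trans h⟩,
    fun hv => ⟨fun hcm => ?_, fun h => ?_⟩⟩
  · by_contra! hlt
    have hev : ∀ᶠ t in atTop,
        Real.cosh (v * t) * (lam - besselRatio v t) ≤ -((v - lam) / 2) := by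
      filter_upwards [(tendsto_besselRatio_atTop (one_pos.trans_le hv)).eventually
        (lt_mem_nhds (show (v + lam) / 2 < v by linarith))] with t ht
      nlinarith [Real.one_le_cosh (v * t)]
    obtain ⟨x, hx, hneg⟩ := exists_laplaceIntegral_neg_of_eventually_le hcont
      (show 0 < (v - lam) / 2 by linarith) hev hint
    exact (hcm.nonneg hx).not_gt (hrepr x hx ▸ hneg)
  · by_contra! hlt
    obtain ⟨x, hx, hneg⟩ := exists_laplaceIntegral_neg_of_neg hcont
      (by simpa [besselRatio_zero] using hlt) hint
    exact (hcm.nonneg hx).not_gt (hrepr x hx ▸ hneg)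
  · by_contra! hlt
    obtain ⟨x, hx, hneg⟩ := exists_laplaceIntegral_neg_of_neg hcont.neg
      (by simpa [besselRatio_zero] using hlt) hnint
    exact (hcm.nonneg hx).not_gt ((hnrepr x hx).trans_lt hneg)
  · refine (laplaceIntegral_completelyMonotonicOn hmeas hnonneg hnint ?_).congr hnrepr
    filter_upwards [ae_restrict_mem measurableSet_Ioi] with t ht
    rw [← mul_neg]
    exact mul_nonneg (Real.cosh_pos _).le
      (by linarith [half_le_besselRatio hv (le_of_lt (mem_Ioi.1 ht))])
end
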